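/- arXiv:1812.01092 — 3 statements merged into one kernel-verified Lean document; each statement's English description precedes it below -/
import Mathlib

section
/- Let X = (X_1,…,X_n) satisfy a 𝔡-LSI(σ²) on a finite product space, let 𝓕 be a family of measurable functions and let g(X) := sup_{f ∈ 𝓕} | Σ_{j=1}^n f(X_j) |, and suppose that for each f ∈ 𝓕 there is a constant c(f) with |f(x) − f(y)| ≤ c(f) for all x, y. Then for all t ≥ 0, ℙ( g(X) ≥ 𝔼 g(X) + t ) ≤ 2 exp( − t² / (15 σ² n · sup_{f ∈ 𝓕} c(f)²) ). -/
open MeasureTheory Finset Real Filter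

noncomputable section

/-- Operator norm of a `k`-tensor indexed by tuples in `[n]^k`. -/
def tOp {n k : ℕ} (A : (Fin k → Fin n) → ℝ) : ℝ :=
  ⨆ v : {v : Fin k → Fin n → ℝ // ∀ j, ∑ i, (v j i) ^ 2 ≤ 1},
    ∑ idx : Fin k → Fin n, (∏ j, v.1 j (idx j)) * A idx

/-- `k`-th order difference `𝔥_{i_1 … i_k} f` (L^∞ taken as sup over the involved coordinates). -/
def hOrd {n : ℕ} {𝒳 : Fin n → Type*} (f : (∀ i, 𝒳 i) → ℝ) (k : ℕ)
    (idx : Fin k → Fin n) (x : ∀ i, 𝒳 i) : ℝ :=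
  ⨆ y : (∀ i, 𝒳 i) × (∀ i, 𝒳 i),
    |∑ S ∈ (Finset.univ : Finset (Fin k)).powerset, (-1 : ℝ) ^ S.card *
      f (fun i => if i ∈ Finset.image idx S then y.2 i
                  else if i ∈ Finset.image idx Finset.univ then y.1 i else x i)|

/-- The `k`-tensor `𝔥^{(k)} f`. -/
def hT {n : ℕ} {𝒳 : Fin n → Type*} (f : (∀ i, 𝒳 i) → ℝ) (k : ℕ)
    (idx : Fin k → Fin n) (x : ∀ i, 𝒳 i) : ℝ :=
  if Function.Injective idx then hOrd f k idx x else 0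

/-- First order difference `𝔥_i f` (sup over both replaced coordinates). -/
def hI {n : ℕ} {𝒳 : Fin n → Type*} (f : (∀ i, 𝒳 i) → ℝ) (i : Fin n) (x : ∀ j, 𝒳 j) : ℝ :=
  ⨆ y : 𝒳 i × 𝒳 i, |f (Function.update x i y.1) - f (Function.update x i y.2)|

/-- `𝔥⁺_i f`. -/
def hPlusI {n : ℕ} {𝒳 : Fin n → Type*} (f : (∀ i, 𝒳 i) → ℝ) (i : Fin n) (x : ∀ j, 𝒳 j) : ℝ :=
  ⨆ y : 𝒳 i, max (f x - f (Function.update x i y)) 0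

/-- `𝔥⁻_i f`. -/
def hMinusI {n : ℕ} {𝒳 : Fin n → Type*} (f : (∀ i, 𝒳 i) → ℝ) (i : Fin n) (x : ∀ j, 𝒳 j) : ℝ :=
  ⨆ y : 𝒳 i, max (f (Function.update x i y) - f x) 0

/-- `L^p(μ)` norm. -/
def lpN {α : Type*} [MeasurableSpace α] (μ : Measure α) (p : ℝ) (g : α → ℝ) : ℝ :=
  (∫ x, |g x| ^ p ∂μ) ^ (1 / p)

/-- Entropy functional `Ent_μ(g)`. -/
def ent {α : Type*} [MeasurableSpace α] (μ : Measure α) (g : α → ℝ) : ℝ :=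
  ∫ x, g x * Real.log (g x) ∂μ - (∫ x, g x ∂μ) * Real.log (∫ x, g x ∂μ)

/-- Variance with respect to a measure. -/
def cVar {β : Type*} [MeasurableSpace β] (ν : Measure β) (g : β → ℝ) : ℝ :=
  ∫ y, (g y - ∫ y', g y' ∂ν) ^ 2 ∂ν

/-- `ν i x` is the conditional distribution of the `i`-th coordinate given the others. -/
def IsCondKernel {n : ℕ} {𝒳 : Fin n → Type*} [∀ i, MeasurableSpace (𝒳 i)]
    (μ : Measure (∀ i, 𝒳 i)) (ν : ∀ i, (∀ j, 𝒳 j) → Measure (𝒳 i)) : Prop :=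
  (∀ i x, IsProbabilityMeasure (ν i x)) ∧
  (∀ i x x', (∀ j, j ≠ i → x j = x' j) → ν i x = ν i x') ∧
  (∀ i (g : (∀ j, 𝒳 j) → ℝ), Measurable g → (∃ M, ∀ x, |g x| ≤ M) →
    ∫ x, ∫ y, g (Function.update x i y) ∂(ν i x) ∂μ = ∫ x, g x ∂μ)

/-- `|𝔡 f|²`. -/
def dSq {n : ℕ} {𝒳 : Fin n → Type*} [∀ i, MeasurableSpace (𝒳 i)]
    (ν : ∀ i, (∀ j, 𝒳 j) → Measure (𝒳 i)) (f : (∀ i, 𝒳 i) → ℝ) (x : ∀ i, 𝒳 i) : ℝ :=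
  ∑ i, cVar (ν i x) (fun y => f (Function.update x i y))

/-- The `𝔡`-logarithmic Sobolev inequality with constant `σ2`. -/
def DLSI {n : ℕ} {𝒳 : Fin n → Type*} [∀ i, MeasurableSpace (𝒳 i)]
    (μ : Measure (∀ i, 𝒳 i)) (ν : ∀ i, (∀ j, 𝒳 j) → Measure (𝒳 i)) (σ2 : ℝ) : Prop :=
  IsCondKernel μ ν ∧
  ∀ f : (∀ i, 𝒳 i) → ℝ, Measurable f → (∃ M, ∀ x, |f x| ≤ M) →
    ent μ (fun x => f x ^ 2) ≤ 2 * σ2 * ∫ x, dSq ν f x ∂μ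

end

/-- On a finite measurable space, a function that does not separate measurably indistinguishable
points is measurable. -/
lemma measurable_of_measurableAtom {Ω : Type*} [MeasurableSpace Ω] [Finite Ω] {g : Ω → ℝ}
    (h : ∀ x, ∀ y ∈ measurableAtom x, g y = g x) : Measurable g := by
  intro s _
  have : g ⁻¹' s = ⋃ x ∈ g ⁻¹' s, measurableAtom x := by
    ext y
    simp only [Set.mem_iUnion, exists_prop]
    constructor
    · intro hy
      exact ⟨y, hy, mem_measurableAtom_self y⟩
    · rintro ⟨x, hx, hy⟩
      rw [Set.mem_preimage, h x y hy]
      exact hx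
  rw [this]
  exact MeasurableSet.biUnion (Set.to_countable _)
    fun x _ => MeasurableSet.measurableAtom_of_countable x

/-- Suprema of arbitrary families of measurable functions on a finite space are measurable. -/
lemma measurable_iSup_of_finite {Ω ι : Type*} [MeasurableSpace Ω] [Finite Ω] {f : ι → Ω → ℝ}
    (hf : ∀ i, Measurable (f i)) : Measurable fun x => ⨆ i, f i x := by
  refine measurable_of_measurableAtom fun x y hy => ?_
  have : ∀ i, f i y = f i x := fun i =>
    mem_of_mem_measurableAtom hy (hf i (measurableSet_singleton (f i x))) rfl
  simp only [this]

lemma bddAbove_range_of_abs_sub_le {ι : Type*} {a b : ι → ℝ} {C : ℝ}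
    (h : ∀ i, |a i - b i| ≤ C) (hb : BddAbove (Set.range b)) : BddAbove (Set.range a) := by
  obtain ⟨M, hM⟩ := hb
  refine ⟨M + C, ?_⟩
  rintro _ ⟨i, rfl⟩
  have h1 := hM ⟨i, rfl⟩
  have h2 := (abs_le.1 (h i)).2
  linarith

/-- Uniformly close families of reals have close (possibly junk-valued) suprema. -/
lemma iSup_sub_iSup_le_of_abs_sub_le {ι : Type*} [Nonempty ι] {a b : ι → ℝ} {C : ℝ}
    (hC : 0 ≤ C) (h : ∀ i, |a i - b i| ≤ C) : (⨆ i, a i) - ⨆ i, b i ≤ C := by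
  by_cases hb : BddAbove (Set.range b)
  · rw [sub_le_iff_le_add]
    refine ciSup_le fun i => ?_
    have h1 := le_ciSup hb i
    have h2 := (abs_le.1 (h i)).2
    linarith
  · have ha : ¬ BddAbove (Set.range a) := fun ha =>
      hb (bddAbove_range_of_abs_sub_le (fun i => abs_sub_comm (a i) (b i) ▸ h i) ha)
    rw [Real.iSup_of_not_bddAbove ha, Real.iSup_of_not_bddAbove hb]
    simpa using hC

/-- The supremum of absolute sums has bounded differences in each coordinate. -/
lemma iSup_abs_sum_update_sub_le {n : ℕ} {𝒳 ι : Type*} [Nonempty ι] {F : ι → 𝒳 → ℝ} {C : ℝ}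
    (hC : 0 ≤ C) (hF : ∀ i x y, |F i x - F i y| ≤ C) (x : Fin n → 𝒳) (k : Fin n) (y z : 𝒳) :
    (⨆ i, |∑ j, F i (Function.update x k y j)|) - ⨆ i, |∑ j, F i (Function.update x k z j)|
      ≤ C := by
  refine iSup_sub_iSup_le_of_abs_sub_le hC fun i => ?_
  refine (abs_abs_sub_abs_le_abs_sub _ _).trans ?_
  rw [← Finset.sum_sub_distrib, Finset.sum_eq_single k]
  · simpa using hF i y z
  · intro j _ hj
    simp [hj]
  · simp

lemma cVar_le_integral_sub_sq {β : Type*} [MeasurableSpace β] (ν : Measure β)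
    [IsProbabilityMeasure ν] {h : β → ℝ} (hh : MemLp h 2 ν) (a : ℝ) :
    cVar ν h ≤ ∫ y, (h y - a) ^ 2 ∂ν := by
  have h1 : cVar ν h = ProbabilityTheory.variance h ν :=
    (ProbabilityTheory.variance_eq_integral hh.aemeasurable).symm
  rw [h1, ← ProbabilityTheory.variance_sub_const hh.aestronglyMeasurable a]
  exact ProbabilityTheory.variance_le_expectation_sq
    (hh.aestronglyMeasurable.sub aestronglyMeasurable_const)

lemma exp_half_sub_sq_le {l a m C : ℝ} (hl : 0 ≤ l) (hma : m ≤ a) (haC : a - m ≤ C) :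
    (Real.exp (l / 2 * a) - Real.exp (l / 2 * m)) ^ 2 ≤ l ^ 2 / 4 * C ^ 2 * Real.exp (l * a) := by
  have h1 : Real.exp (l / 2 * a) - Real.exp (l / 2 * m) ≤ l / 2 * C * Real.exp (l / 2 * a) := by
    have h2 := Real.add_one_le_exp (l / 2 * m - l / 2 * a)
    have h3 : Real.exp (l / 2 * m) = Real.exp (l / 2 * m - l / 2 * a) * Real.exp (l / 2 * a) := by
      rw [← Real.exp_add]; ring_nf
    have h4 : 1 - l / 2 * C ≤ Real.exp (l / 2 * m - l / 2 * a) := by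
      nlinarith [mul_le_mul_of_nonneg_left haC hl]
    rw [h3]
    nlinarith [mul_le_mul_of_nonneg_right h4 (Real.exp_pos (l / 2 * a)).le]
  have h0 : 0 ≤ Real.exp (l / 2 * a) - Real.exp (l / 2 * m) := by
    rw [sub_nonneg, Real.exp_le_exp]
    gcongr
  have h5 : Real.exp (l * a) = Real.exp (l / 2 * a) ^ 2 := by
    rw [← Real.exp_nat_mul]; push_cast; ring_nf
  calc _ ≤ (l / 2 * C * Real.exp (l / 2 * a)) ^ 2 := by gcongr
    _ = _ := by rw [h5]; ring

lemma cVar_exp_half_le {β : Type*} [MeasurableSpace β] [Finite β] (ν : Measure β)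
    [IsProbabilityMeasure ν] {h : β → ℝ} (hh : Measurable h) {C l : ℝ} (hl : 0 ≤ l)
    (hC : ∀ y z, h y - h z ≤ C) :
    cVar ν (fun y => Real.exp (l / 2 * h y)) ≤
      l ^ 2 / 4 * C ^ 2 * ∫ y, Real.exp (l * h y) ∂ν := by
  have hβ : Nonempty β := nonempty_of_isProbabilityMeasure ν
  obtain ⟨z, hz⟩ := Finite.exists_min h
  have hint : ∀ f : β → ℝ, Measurable f → Integrable f ν := fun f hf => by
    obtain ⟨M, hM⟩ := (Set.finite_range fun x => |f x|).bddAbove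
    exact Integrable.of_bound hf.aestronglyMeasurable M (ae_of_all _ fun x => hM ⟨x, rfl⟩)
  have hLp : MemLp (fun y => Real.exp (l / 2 * h y)) 2 ν := by
    obtain ⟨M, hM⟩ := (Set.finite_range fun x => ‖Real.exp (l / 2 * h x)‖).bddAbove
    exact MemLp.of_bound (by fun_prop) M (ae_of_all _ fun x => hM ⟨x, rfl⟩)
  refine (cVar_le_integral_sub_sq ν hLp (Real.exp (l / 2 * h z))).trans ?_
  rw [← integral_const_mul]
  refine integral_mono (hint _ (by fun_prop)) (hint _ (by fun_prop)) fun y => ?_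
  exact exp_half_sub_sq_le hl (hz y) (hC y z)

/-- A `𝔡`-LSI bounds the entropy of exponentials of functions with bounded differences. -/
lemma DLSI.ent_exp_le {n : ℕ} {𝒳 : Type*} [MeasurableSpace 𝒳] [Finite 𝒳]
    {μ : Measure (Fin n → 𝒳)} [IsProbabilityMeasure μ]
    {ν : Fin n → (Fin n → 𝒳) → Measure 𝒳} {σ2 : ℝ} (hLSI : DLSI μ ν σ2) (hσ : 0 ≤ σ2)
    {g : (Fin n → 𝒳) → ℝ} (hg : Measurable g) {C l : ℝ} (hl : 0 ≤ l)
    (hC : ∀ x i y z, g (Function.update x i y) - g (Function.update x i z) ≤ C) :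
    ent μ (fun x => Real.exp (l * g x)) ≤
      σ2 * n * C ^ 2 / 2 * l ^ 2 * ∫ x, Real.exp (l * g x) ∂μ := by
  obtain ⟨⟨hν, -, hcond⟩, hent⟩ := hLSI
  have hbdd : ∀ f : (Fin n → 𝒳) → ℝ, ∃ M, ∀ x, |f x| ≤ M := fun f => by
    obtain ⟨M, hM⟩ := (Set.finite_range fun x => |f x|).bddAbove
    exact ⟨M, fun x => hM ⟨x, rfl⟩⟩
  have hint : ∀ f : (Fin n → 𝒳) → ℝ, Measurable f → Integrable f μ := fun f hf => by
    obtain ⟨M, hM⟩ := hbdd f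
    exact Integrable.of_bound hf.aestronglyMeasurable M (ae_of_all _ hM)
  have hpos : 0 < ∫ x, Real.exp (l * g x) ∂μ := integral_exp_pos (hint _ (by fun_prop))
  have h1 := hent (fun x => Real.exp (l / 2 * g x)) (by fun_prop) (hbdd _)
  have hsq : (fun x => Real.exp (l / 2 * g x) ^ 2) = fun x => Real.exp (l * g x) := by
    funext x
    rw [← Real.exp_nat_mul]; push_cast; ring_nf
  rw [hsq] at h1
  have hk : ∀ i, ∫ x, ∫ y, Real.exp (l * g (Function.update x i y)) ∂(ν i x) ∂μ
      = ∫ x, Real.exp (l * g x) ∂μ := fun i =>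
    hcond i (fun x => Real.exp (l * g x)) (by fun_prop) (hbdd _)
  have hki : ∀ i, Integrable (fun x => ∫ y, Real.exp (l * g (Function.update x i y)) ∂(ν i x)) μ :=
    fun i => by
      by_contra hni
      have := hk i
      rw [integral_undef hni] at this
      exact hpos.ne this
  have h2 : ∫ x, dSq ν (fun x => Real.exp (l / 2 * g x)) x ∂μ ≤
      ∫ x, ∑ i, l ^ 2 / 4 * C ^ 2 * ∫ y, Real.exp (l * g (Function.update x i y)) ∂(ν i x) ∂μ := by
    refine integral_mono_of_nonneg (ae_of_all _ fun x => ?_)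
      (integrable_finsetSum _ fun i _ => (hki i).const_mul _) (ae_of_all _ fun x => ?_)
    · exact Finset.sum_nonneg fun i _ => integral_nonneg fun y => sq_nonneg _
    · refine Finset.sum_le_sum fun i _ => ?_
      have := hν i x
      exact cVar_exp_half_le (ν i x) (hg.comp (measurable_update x)) hl (hC x i)
  rw [integral_finsetSum _ fun i _ => (hki i).const_mul _] at h2
  simp only [integral_const_mul, hk, Finset.sum_const, Finset.card_univ, Fintype.card_fin,
    nsmul_eq_mul] at h2
  calc _ ≤ _ := h1
    _ ≤ 2 * σ2 * (n * (l ^ 2 / 4 * C ^ 2 * ∫ x, Real.exp (l * g x) ∂μ)) := by gcongr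
    _ = _ := by ring

/-- **Herbst argument**: a quadratic bound on the entropy of `exp (l * g)` yields a quadratic bound
on the cumulant generating function of `g`. -/
lemma cgf_le_of_ent_exp_le {Ω : Type*} [MeasurableSpace Ω] {μ : Measure Ω}
    [IsProbabilityMeasure μ] {g : Ω → ℝ} (hint : ∀ l, Integrable (fun x => Real.exp (l * g x)) μ)
    {K : ℝ} (hK : ∀ l, 0 < l →
      ent μ (fun x => Real.exp (l * g x)) ≤ K * l ^ 2 * ∫ x, Real.exp (l * g x) ∂μ)
    {l : ℝ} (hl : 0 < l) :
    ProbabilityTheory.cgf g μ l ≤ l * ∫ x, g x ∂μ + K * l ^ 2 := by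
  have hset : ∀ s, s ∈ interior (ProbabilityTheory.integrableExpSet g μ) := fun s => by
    have : ProbabilityTheory.integrableExpSet g μ = Set.univ :=
      Set.eq_univ_of_forall hint
    simp [this]
  set φ := ProbabilityTheory.cgf g μ with hφ
  have hφ0 : φ 0 = 0 := by simp [hφ]
  have hder : ∀ s, HasDerivAt φ (deriv φ s) s := fun s =>
    (ProbabilityTheory.analyticAt_cgf (hset s)).differentiableAt.hasDerivAt
  have hder0 : deriv φ 0 = ∫ x, g x ∂μ := by
    simp [hφ, ProbabilityTheory.deriv_cgf_zero (hset 0)]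
  have hineq : ∀ s, 0 < s → s * deriv φ s - φ s ≤ K * s ^ 2 := fun s hs => by
    have hpos : 0 < ∫ x, Real.exp (s * g x) ∂μ := integral_exp_pos (hint s)
    have h := hK s hs
    rw [hφ, ProbabilityTheory.deriv_cgf (hset s)]
    simp only [ProbabilityTheory.cgf, ProbabilityTheory.mgf]
    simp only [ent, Real.log_exp] at h
    have e : ∫ x, Real.exp (s * g x) * (s * g x) ∂μ = s * ∫ x, g x * Real.exp (s * g x) ∂μ := by
      rw [← integral_const_mul]
      congr 1; funext x; ring
    rw [e] at h
    rw [mul_div_assoc', sub_le_iff_le_add, div_le_iff₀ hpos]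
    linarith
  set ψ : ℝ → ℝ := fun s => dslope φ 0 s - K * s with hψ
  have hdslope : ∀ s, s ≠ 0 → dslope φ 0 s = φ s / s := fun s hs => by
    rw [dslope_of_ne _ hs, slope_def_field, hφ0, sub_zero, sub_zero]
  have hψder : ∀ s, 0 < s → HasDerivAt ψ ((deriv φ s * s - φ s) / s ^ 2 - K) s := fun s hs => by
    have h1 : HasDerivAt (fun s => φ s / s - K * s) ((deriv φ s * s - φ s * 1) / s ^ 2 - K * 1) s :=
      ((hder s).div (hasDerivAt_id s) hs.ne').sub ((hasDerivAt_id s).const_mul K)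
    rw [mul_one, mul_one] at h1
    refine h1.congr_of_eventuallyEq ?_
    filter_upwards [eventually_ne_nhds hs.ne'] with u hu
    simp only [hψ, hdslope u hu]
  have hanti : AntitoneOn ψ (Set.Ici 0) := by
    refine antitoneOn_of_deriv_nonpos (convex_Ici 0) ?_ ?_ ?_
    · intro s hs
      refine ContinuousAt.continuousWithinAt ?_
      rcases eq_or_lt_of_le (Set.mem_Ici.1 hs) with rfl | hs
      · exact (continuousAt_dslope_same.2 (hder 0).differentiableAt).sub (by fun_prop)
      · exact (hψder s hs).continuousAt
    · rw [interior_Ici]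
      exact fun s hs => (hψder s hs).differentiableAt.differentiableWithinAt
    · rw [interior_Ici]
      intro s hs
      have hs : 0 < s := hs
      rw [(hψder s hs).deriv, sub_nonpos, div_le_iff₀ (by positivity)]
      linarith [hineq s hs]
  have h := hanti (Set.mem_Ici.2 le_rfl) (Set.mem_Ici.2 hl.le) hl.le
  simp only [hψ, hdslope l hl.ne', dslope_same, hder0, mul_zero, sub_zero] at h
  rw [sub_le_iff_le_add, div_le_iff₀ hl] at h
  linarith

/-- A `𝔡`-LSI implies Gaussian upper tails for functions with bounded differences. -/
lemma DLSI.measureReal_ge_le {n : ℕ} {𝒳 : Type*} [MeasurableSpace 𝒳] [Finite 𝒳]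
    {μ : Measure (Fin n → 𝒳)} [IsProbabilityMeasure μ]
    {ν : Fin n → (Fin n → 𝒳) → Measure 𝒳} {σ2 : ℝ} (hLSI : DLSI μ ν σ2)
    {g : (Fin n → 𝒳) → ℝ} (hg : Measurable g) {C : ℝ}
    (hC : ∀ x i y z, g (Function.update x i y) - g (Function.update x i z) ≤ C)
    (hpos : 0 < σ2 * n * C ^ 2) {t : ℝ} (ht : 0 ≤ t) :
    μ.real {x | (∫ y, g y ∂μ) + t ≤ g x} ≤ Real.exp (-(t ^ 2) / (2 * (σ2 * n * C ^ 2))) := by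
  have hint : ∀ l, Integrable (fun x => Real.exp (l * g x)) μ := fun l => by
    obtain ⟨M, hM⟩ := (Set.finite_range fun x => ‖Real.exp (l * g x)‖).bddAbove
    exact Integrable.of_bound (by fun_prop) M (ae_of_all _ fun x => hM ⟨x, rfl⟩)
  rcases ht.eq_or_lt with rfl | ht
  · simp
  have hσ : 0 ≤ σ2 := by
    by_contra! h
    have : 0 ≤ n * C ^ 2 := by positivity
    nlinarith
  set D := σ2 * n * C ^ 2 with hD
  have hl : 0 < t / D := div_pos ht hpos
  have h1 := cgf_le_of_ent_exp_le hint (K := D / 2)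
    (fun l hl => hLSI.ent_exp_le hσ hg hl.le hC) hl
  refine (ProbabilityTheory.measure_ge_le_exp_cgf _ hl.le (hint _)).trans ?_
  rw [Real.exp_le_exp]
  calc _ ≤ -(t / D) * ((∫ y, g y ∂μ) + t) +
        (t / D * ∫ x, g x ∂μ + D / 2 * (t / D) ^ 2) := by gcongr
    _ = _ := by field_simp; ring

/-- a uniform bounded-differences deviation inequality for suprema of sums
under a `𝔡`-LSI (Proposition `prop:SupremaOfSums`). -/
theorem stmt4 {n : ℕ} {𝒳 : Type*} [MeasurableSpace 𝒳] [Fintype 𝒳]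
    (μ : Measure (Fin n → 𝒳)) (hμ : IsProbabilityMeasure μ)
    (ν : ∀ i : Fin n, (Fin n → 𝒳) → Measure 𝒳) (σ2 : ℝ) (hLSI : DLSI μ ν σ2)
    {ι : Type*} [Nonempty ι] (F : ι → 𝒳 → ℝ) (hFm : ∀ i, Measurable (F i))
    (c : ι → ℝ) (hc : ∀ i x y, |F i x - F i y| ≤ c i) (hcb : ∃ M, ∀ i, c i ≤ M)
    (t : ℝ) (ht : 0 ≤ t) :
    μ {x | (∫ y, (⨆ i, |∑ j, F i (y j)|) ∂μ) + t ≤ ⨆ i, |∑ j, F i (x j)|} ≤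
      ENNReal.ofReal (2 * Real.exp (-(t ^ 2) / (15 * σ2 * n * ⨆ i, c i ^ 2))) := by
  set S := ⨆ i, c i ^ 2
  rcases le_or_gt (15 * σ2 * n * S) 0 with hD | hD
  · have h1 : 1 ≤ Real.exp (-(t ^ 2) / (15 * σ2 * n * S)) :=
      Real.one_le_exp (div_nonneg_of_nonpos (neg_nonpos.2 (sq_nonneg t)) hD)
    refine prob_le_one.trans ?_
    rw [ENNReal.one_le_ofReal]
    linarith
  have hn : 0 < n := by
    rcases Nat.eq_zero_or_pos n with rfl | h
    · simp at hD
    · exact h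
  have h𝒳 : Nonempty 𝒳 := (nonempty_of_isProbabilityMeasure μ).map fun x => x ⟨0, hn⟩
  have hc0 : ∀ i, 0 ≤ c i := fun i =>
    (abs_nonneg _).trans (hc i (Classical.arbitrary 𝒳) (Classical.arbitrary 𝒳))
  have hS0 : 0 ≤ S := Real.iSup_nonneg fun i => sq_nonneg _
  have hcS : ∀ i, c i ≤ √S := fun i => by
    obtain ⟨M, hM⟩ := hcb
    refine Real.le_sqrt_of_sq_le (le_ciSup (f := fun i => c i ^ 2) ⟨M ^ 2, ?_⟩ i)
    rintro _ ⟨j, rfl⟩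
    exact pow_le_pow_left₀ (hc0 j) (hM j) 2
  have hg : Measurable fun x : Fin n → 𝒳 => ⨆ i, |∑ j, F i (x j)| :=
    measurable_iSup_of_finite fun i => by fun_prop
  have hsq : √S ^ 2 = S := Real.sq_sqrt hS0
  have hpos : 0 < σ2 * n * √S ^ 2 := by
    rw [hsq]; linarith
  have h := hLSI.measureReal_ge_le hg
    (iSup_abs_sum_update_sub_le (Real.sqrt_nonneg S) fun i x y => (hc i x y).trans (hcS i)) hpos ht
  rw [hsq] at h hpos
  rw [← ofReal_measureReal]
  refine ENNReal.ofReal_le_ofReal (h.trans ?_)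
  have h2 : -(t ^ 2) / (2 * (σ2 * n * S)) ≤ -(t ^ 2) / (15 * σ2 * n * S) := by
    rw [neg_div, neg_div, neg_le_neg_iff]
    refine div_le_div_of_nonneg_left (sq_nonneg t) (by linarith) (by linarith)
  have h3 := Real.exp_le_exp.2 h2
  linarith [Real.exp_pos (-(t ^ 2) / (15 * σ2 * n * S))]
end

section
/- Let X = (X_1,…,X_n) be a random vector supported in [a,b]^n (a < b real) satisfying a 𝔡-LSI(σ²), and let f(X) = sup_{t ∈ 𝒯} ‖ Σ_{I ∈ 𝓘_{n,d}} X_I t_I ‖. Then for all p ≥ 2, ‖(f(X) − 𝔼f(X))_+‖_p ≤ Σ_{j=1}^d (2σ²(b−a)²(p − 3/2))^{j/2} 𝔼 W_j, and for all t ≥ 0, ℙ( f(X) − 𝔼f(X) ≥ t ) ≤ 2 exp( −(1/(2e²σ²(b−a)²d²)) · min_{k=1,…,d} ( t / 𝔼 W_k )^{2/k} ). The same concentration inequality holds with 𝔼 W_k replaced by 𝔼 W̃_k. -/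
open MeasureTheory Finset Real Filter

noncomputable section

/-- `𝓘_{n,d}`: the `d`-element subsets of `[n]`. -/
def IdxSet (n d : ℕ) := {S : Finset (Fin n) // S.card = d}

instance (n d : ℕ) : Fintype (IdxSet n d) := by unfold IdxSet; infer_instance

/-- `Σ_{I ∈ 𝓘_{n,d}} X_I t_I`. -/
def chaosSum {n d : ℕ} {B : Type*} [NormedAddCommGroup B] [NormedSpace ℝ B]
    (t : IdxSet n d → B) (x : Fin n → ℝ) : B :=
  ∑ S : IdxSet n d, (∏ i ∈ S.1, x i) • t S

/-- `f_𝒯(x) = sup_{t ∈ 𝒯} ‖Σ_{I ∈ 𝓘_{n,d}} x_I t_I‖`. -/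
def fSup {n d : ℕ} {B : Type*} [NormedAddCommGroup B] [NormedSpace ℝ B]
    (𝒯 : Set (IdxSet n d → B)) (x : Fin n → ℝ) : ℝ :=
  ⨆ t : 𝒯, ‖chaosSum t.1 x‖

/-- `Σ_{I ∈ 𝓘_{n,d-k}, i_1,…,i_k ∉ I} X_I t_{I ∪ {i_1,…,i_k}}` for a tuple
`idx = (i_1,…,i_k)` of (distinct) indices. -/
def chaosPartial {n d k : ℕ} {B : Type*} [NormedAddCommGroup B] [NormedSpace ℝ B]
    (t : IdxSet n d → B) (x : Fin n → ℝ) (idx : Fin k → Fin n) : B :=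
  ∑ I ∈ Finset.univ.filter (fun I : Finset (Fin n) => I.card = d - k ∧ ∀ s, idx s ∉ I),
    (∏ i ∈ I, x i) •
      (if h : (I ∪ Finset.image idx Finset.univ).card = d
        then t ⟨I ∪ Finset.image idx Finset.univ, h⟩ else 0)

/-- The quantity `W_k`. -/
def Wfun {n d : ℕ} {B : Type*} [NormedAddCommGroup B] [NormedSpace ℝ B]
    (𝒯 : Set (IdxSet n d → B)) (k : ℕ) (x : Fin n → ℝ) : ℝ :=
  ⨆ t : 𝒯, ⨆ α : {α : Fin k → Fin n → ℝ // ∀ j, ∑ i, α j i ^ 2 ≤ 1},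
    ‖∑ idx ∈ Finset.univ.filter (fun idx : Fin k → Fin n => Function.Injective idx),
        (∏ j, α.1 j (idx j)) • chaosPartial t.1 x idx‖

/-- The quantity `W̃_k`. -/
def Wtil {n d : ℕ} {B : Type*} [NormedAddCommGroup B] [NormedSpace ℝ B]
    (𝒯 : Set (IdxSet n d → B)) (k : ℕ) (x : Fin n → ℝ) : ℝ :=
  ⨆ α : {α : Fin k → Fin n → ℝ // ∀ j, ∑ i, α j i ^ 2 ≤ 1},
    ∑ idx ∈ Finset.univ.filter (fun idx : Fin k → Fin n => Function.Injective idx),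
      (∏ j, α.1 j (idx j)) * (⨆ t : 𝒯, ‖chaosPartial t.1 x idx‖)

/-- Bounded measurable real functions. -/
def IsBddMeas {α : Type*} [MeasurableSpace α] (g : α → ℝ) : Prop :=
  Measurable g ∧ ∃ M, ∀ x, |g x| ≤ M

namespace IsBddMeas

variable {α : Type*} [MeasurableSpace α] {f g : α → ℝ}

lemma const (c : ℝ) : IsBddMeas (fun _ : α => c) := ⟨measurable_const, |c|, fun _ => le_rfl⟩

lemma continuous_comp {φ : ℝ → ℝ} (hφ : Continuous φ) (hf : IsBddMeas f) :
    IsBddMeas (fun x => φ (f x)) := by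
  obtain ⟨hf, M, hM⟩ := hf
  obtain ⟨C, hC⟩ := (isCompact_Icc (a := -M) (b := M)).exists_bound_of_continuousOn
    hφ.continuousOn
  exact ⟨hφ.measurable.comp hf, C, fun x => hC _ (abs_le.1 (hM x))⟩

lemma add (hf : IsBddMeas f) (hg : IsBddMeas g) : IsBddMeas (fun x => f x + g x) := by
  obtain ⟨hf, M, hM⟩ := hf
  obtain ⟨hg, N, hN⟩ := hg
  exact ⟨hf.add hg, M + N, fun x => (abs_add_le _ _).trans (add_le_add (hM x) (hN x))⟩

lemma sub (hf : IsBddMeas f) (hg : IsBddMeas g) : IsBddMeas (fun x => f x - g x) := by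
  simpa [sub_eq_add_neg] using hf.add (hg.continuous_comp continuous_neg)

lemma mul (hf : IsBddMeas f) (hg : IsBddMeas g) : IsBddMeas (fun x => f x * g x) := by
  obtain ⟨hf, M, hM⟩ := hf
  obtain ⟨hg, N, hN⟩ := hg
  refine ⟨hf.mul hg, M * N, fun x => ?_⟩
  rw [abs_mul]
  exact mul_le_mul (hM x) (hN x) (abs_nonneg _) ((abs_nonneg _).trans (hM x))

lemma pow (hf : IsBddMeas f) (k : ℕ) : IsBddMeas (fun x => f x ^ k) :=
  hf.continuous_comp (continuous_pow k)

lemma rpow (hf : IsBddMeas f) {r : ℝ} (hr : 0 ≤ r) : IsBddMeas (fun x => f x ^ r) :=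
  hf.continuous_comp (Real.continuous_rpow_const hr)

lemma abs (hf : IsBddMeas f) : IsBddMeas (fun x => |f x|) :=
  hf.continuous_comp continuous_abs

lemma posPart (hf : IsBddMeas f) : IsBddMeas (fun x => max (f x) 0) :=
  hf.continuous_comp (φ := fun t => max t 0) (by fun_prop)

lemma integrable (hf : IsBddMeas f) (μ : Measure α) [IsFiniteMeasure μ] : Integrable f μ := by
  obtain ⟨hf, M, hM⟩ := hf
  exact Integrable.of_bound hf.aestronglyMeasurable M (.of_forall hM)

lemma memLp (hf : IsBddMeas f) (μ : Measure α) [IsFiniteMeasure μ] (p : ENNReal) :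
    MemLp f p μ := by
  obtain ⟨hf, M, hM⟩ := hf
  exact MemLp.of_bound hf.aestronglyMeasurable M (.of_forall hM)

lemma integral_quadratic (hf : IsBddMeas f) (μ : Measure α) [IsProbabilityMeasure μ]
    (a b c : ℝ) : ∫ x, (a + b * f x + c * f x ^ 2) ∂μ =
      a + b * ∫ x, f x ∂μ + c * ∫ x, f x ^ 2 ∂μ := by
  have h1 := (hf.integrable μ).const_mul b
  have h2 := ((hf.pow 2).integrable μ).const_mul c
  rw [integral_add (f := fun x => a + b * f x) ((integrable_const a).add h1) h2,
    integral_add (integrable_const a) h1, integral_const_mul, integral_const_mul]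
  simp

end IsBddMeas

section LpNorm

variable {α : Type*} [MeasurableSpace α] {μ : Measure α} {f g : α → ℝ} {p q : ℝ}

lemma lpN_nonneg (μ : Measure α) (p : ℝ) (g : α → ℝ) : 0 ≤ lpN μ p g :=
  Real.rpow_nonneg (integral_nonneg fun _ => Real.rpow_nonneg (abs_nonneg _) _) _

lemma ofReal_lpN (hp : 0 < p) (hf : MemLp f (ENNReal.ofReal p) μ) :
    ENNReal.ofReal (lpN μ p f) = eLpNorm f (ENNReal.ofReal p) μ := by
  rw [hf.eLpNorm_eq_integral_rpow_norm (by simpa using hp) ENNReal.ofReal_ne_top]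
  simp [lpN, ENNReal.toReal_ofReal hp.le]

lemma lpN_mono_exponent [IsProbabilityMeasure μ] (hp : 0 < p) (hpq : p ≤ q)
    (hf : IsBddMeas f) : lpN μ p f ≤ lpN μ q f := by
  rw [← ENNReal.ofReal_le_ofReal_iff (lpN_nonneg _ _ _), ofReal_lpN hp (hf.memLp _ _),
    ofReal_lpN (hp.trans_le hpq) (hf.memLp _ _)]
  exact eLpNorm_le_eLpNorm_of_exponent_le (ENNReal.ofReal_le_ofReal hpq)
    hf.1.aestronglyMeasurable

lemma lpN_mono [IsFiniteMeasure μ] (hp : 0 < p) (hf : IsBddMeas f) (hg : IsBddMeas g)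
    (hfg : ∀ x, |f x| ≤ |g x|) : lpN μ p f ≤ lpN μ p g :=
  Real.rpow_le_rpow (integral_nonneg fun _ => by positivity)
    (integral_mono ((hf.abs.rpow hp.le).integrable μ) ((hg.abs.rpow hp.le).integrable μ)
      fun x => Real.rpow_le_rpow (abs_nonneg _) (hfg x) hp.le) (by positivity)

lemma lpN_add_le [IsFiniteMeasure μ] (hp : 1 ≤ p) (hf : IsBddMeas f) (hg : IsBddMeas g) :
    lpN μ p (fun x => f x + g x) ≤ lpN μ p f + lpN μ p g := by
  have h0 : 0 < p := by linarith
  rw [← ENNReal.ofReal_le_ofReal_iff (add_nonneg (lpN_nonneg _ _ _) (lpN_nonneg _ _ _)),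
    ENNReal.ofReal_add (lpN_nonneg _ _ _) (lpN_nonneg _ _ _),
    ofReal_lpN h0 (hf.memLp _ _), ofReal_lpN h0 (hg.memLp _ _),
    ofReal_lpN h0 ((hf.add hg).memLp _ _)]
  exact eLpNorm_add_le hf.1.aestronglyMeasurable hg.1.aestronglyMeasurable
    (by simpa using hp)

lemma lpN_const [IsProbabilityMeasure μ] (hp : 0 < p) {c : ℝ} (hc : 0 ≤ c) :
    lpN μ p (fun _ => c) = c := by
  simp [lpN, abs_of_nonneg hc, ← Real.rpow_mul hc, hp.ne']

lemma lpN_const_mul (hp : 0 < p) {c : ℝ} (hc : 0 ≤ c) :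
    lpN μ p (fun x => c * f x) = c * lpN μ p f := by
  simp only [lpN, abs_mul, abs_of_nonneg hc, Real.mul_rpow hc (abs_nonneg _),
    integral_const_mul]
  rw [Real.mul_rpow (by positivity) (integral_nonneg fun _ => by positivity),
    ← Real.rpow_mul hc, mul_one_div_cancel hp.ne', Real.rpow_one]

lemma lpN_congr_ae (h : f =ᵐ[μ] g) : lpN μ p f = lpN μ p g := by
  unfold lpN
  rw [integral_congr_ae (g := fun x => |g x| ^ p) (h.mono fun x hx => by simp only [hx])]

lemma lpN_rpow (hp : 0 < p) : lpN μ p f ^ p = ∫ x, |f x| ^ p ∂μ := by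
  rw [lpN, ← Real.rpow_mul (integral_nonneg fun _ => by positivity),
    one_div_mul_cancel hp.ne', Real.rpow_one]

lemma lpN_two_sq : lpN μ 2 f ^ 2 = ∫ x, f x ^ 2 ∂μ := by
  rw [← Real.rpow_natCast]
  simpa using lpN_rpow (μ := μ) (f := f) (p := 2) two_pos

end LpNorm

lemma cVar_le_integral_sq {β : Type*} [MeasurableSpace β] (ν : Measure β)
    [IsProbabilityMeasure ν] {g : β → ℝ} (hg : IsBddMeas g) (c : ℝ) :
    cVar ν g ≤ ∫ y, (g y - c) ^ 2 ∂ν := by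
  have h1 : cVar ν g = ProbabilityTheory.variance g ν :=
    (ProbabilityTheory.variance_eq_integral hg.1.aemeasurable).symm
  rw [h1, ← ProbabilityTheory.variance_sub_const hg.1.aestronglyMeasurable c]
  exact ProbabilityTheory.variance_le_expectation_sq
    (hg.sub (.const c)).1.aestronglyMeasurable

section LogSobolev

variable {n : ℕ} {𝒳 : Fin n → Type*} [∀ i, MeasurableSpace (𝒳 i)]
  {μ : Measure (∀ i, 𝒳 i)} [IsProbabilityMeasure μ]
  {ν : ∀ i, (∀ j, 𝒳 j) → Measure (𝒳 i)} {σ2 : ℝ}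

lemma IsBddMeas.comp_update {g : (∀ j, 𝒳 j) → ℝ} (hg : IsBddMeas g) (i : Fin n)
    (x : ∀ j, 𝒳 j) : IsBddMeas (fun y => g (Function.update x i y)) :=
  ⟨hg.1.comp (measurable_update x), hg.2.imp fun _ hM _ => hM _⟩

lemma IsCondKernel.integrable_integral_update (h : IsCondKernel μ ν) (i : Fin n)
    {g : (∀ j, 𝒳 j) → ℝ} (hg : IsBddMeas g) :
    Integrable (fun x => ∫ y, g (Function.update x i y) ∂(ν i x)) μ := by
  obtain ⟨hp, -, hc⟩ := h
  by_contra hn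
  have h0 := hc i g hg.1 hg.2
  rw [integral_undef hn] at h0
  have hg1 := hg.add (.const 1)
  have h1 := hc i _ hg1.1 hg1.2
  have heq : (fun x => ∫ y, (g (Function.update x i y) + 1) ∂(ν i x)) =
      fun x => (∫ y, g (Function.update x i y) ∂(ν i x)) + 1 := by
    funext x
    have := hp i x
    rw [integral_add ((hg.comp_update i x).integrable _) (integrable_const _)]
    simp
  rw [heq, integral_undef, integral_add (hg.integrable μ) (integrable_const _), ← h0] at h1
  · simp at h1
  · intro hi
    refine hn ((hi.sub (integrable_const (1 : ℝ))).congr (.of_forall fun x => ?_))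
    simp

lemma DLSI.ent_sq_le (h : DLSI μ ν σ2) (hσ : 0 ≤ σ2) {f : (∀ j, 𝒳 j) → ℝ}
    (hf : IsBddMeas f) {m : Fin n → (∀ j, 𝒳 j) → ℝ} (hm : ∀ i, IsBddMeas (m i))
    (hmi : ∀ i x y, m i (Function.update x i y) = m i x) :
    ent μ (fun x => f x ^ 2) ≤ 2 * σ2 * ∫ x, ∑ i, (f x - m i x) ^ 2 ∂μ := by
  obtain ⟨hK, hL⟩ := h
  refine (hL f hf.1 hf.2).trans (mul_le_mul_of_nonneg_left ?_ (by positivity))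
  have hb : ∀ i, IsBddMeas (fun x => (f x - m i x) ^ 2) := fun i => (hf.sub (hm i)).pow 2
  calc ∫ x, dSq ν f x ∂μ
      ≤ ∫ x, ∑ i, ∫ y, (f (Function.update x i y) - m i (Function.update x i y)) ^ 2
          ∂(ν i x) ∂μ := by
        refine integral_mono_of_nonneg (.of_forall fun x => ?_) ?_ (.of_forall fun x => ?_)
        · exact Finset.sum_nonneg fun i _ => integral_nonneg fun y => sq_nonneg _
        · exact integrable_finsetSum _ fun i _ => hK.integrable_integral_update i (hb i)
        · refine Finset.sum_le_sum fun i _ => ?_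
          have := hK.1 i x
          simp only [hmi]
          exact cVar_le_integral_sq _ (hf.comp_update i x) _
    _ = ∫ x, ∑ i, (f x - m i x) ^ 2 ∂μ := by
        rw [integral_finsetSum _ fun i _ => hK.integrable_integral_update i (hb i),
          integral_finsetSum _ fun i _ => (hb i).integrable μ]
        exact Finset.sum_congr rfl fun i _ => hK.2.2 i _ (hb i).1 (hb i).2

lemma sq_mul_log_sq_lower {s : ℝ} (hs : |s| ≤ 1 / 2) :
    2 * s + 3 * s ^ 2 - 10 * |s| ^ 3 ≤ (1 + s) ^ 2 * Real.log ((1 + s) ^ 2) := by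
  have h := Real.abs_log_sub_add_sum_range_le (x := -s) (by rw [abs_neg]; linarith) 2
  rw [abs_neg] at h
  have h2 : |s| ^ (2 + 1) / (1 - |s|) ≤ 2 * |s| ^ 3 := by
    rw [div_le_iff₀ (by linarith)]
    rw [show 2 + 1 = 3 from rfl]
    nlinarith [pow_nonneg (abs_nonneg s) 3]
  have h3 := (abs_le.1 (h.trans h2)).1
  simp only [Finset.sum_range_succ, Finset.sum_range_zero, sub_neg_eq_add] at h3
  norm_num at h3
  have h4 : s - s ^ 2 / 2 - 2 * |s| ^ 3 ≤ Real.log (1 + s) := by linarith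
  obtain ⟨h5, h6⟩ := abs_le.1 hs
  rw [Real.log_pow]
  push_cast
  have h7 := mul_le_mul_of_nonneg_left h4 (sq_nonneg (1 + s))
  have h8 : (1 + s) ^ 2 ≤ 9 / 4 := by nlinarith
  have h9 := mul_le_mul_of_nonneg_right h8 (pow_nonneg (abs_nonneg s) 3)
  have h10 : s ^ 4 ≤ |s| ^ 3 * (1 / 2) := by
    have : s ^ 4 = |s| ^ 3 * |s| := by
      rw [← pow_succ, ← abs_pow]; exact (abs_of_nonneg (by positivity)).symm
    rw [this]
    exact mul_le_mul_of_nonneg_left hs (by positivity)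
  nlinarith [pow_nonneg (abs_nonneg s) 3]

/-- The Poincaré inequality implied by a `𝔡`-LSI, for centered functions. -/
lemma DLSI.integral_sq_le (h : DLSI μ ν σ2) (hσ : 0 ≤ σ2) {f : (∀ j, 𝒳 j) → ℝ}
    (hf : IsBddMeas f) (hf0 : ∫ x, f x ∂μ = 0) {m : Fin n → (∀ j, 𝒳 j) → ℝ}
    (hm : ∀ i, IsBddMeas (m i)) (hmi : ∀ i x y, m i (Function.update x i y) = m i x) :
    ∫ x, f x ^ 2 ∂μ ≤ σ2 * ∫ x, ∑ i, (f x - m i x) ^ 2 ∂μ := by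
  obtain ⟨M₀, hM₀⟩ := hf.2
  set M := max M₀ 1
  have hM : ∀ x, |f x| ≤ M := fun x => (hM₀ x).trans (le_max_left _ _)
  have hM1 : 1 ≤ M := le_max_right _ _
  set v := ∫ x, f x ^ 2 ∂μ
  set D := ∫ x, ∑ i, (f x - m i x) ^ 2 ∂μ
  have key : ∀ ε ∈ Set.Ioo (0 : ℝ) (1 / (2 * M)),
      (2 - 10 * M * ε) * v - ε ^ 2 * v ^ 2 ≤ 2 * σ2 * D := by
    rintro ε ⟨hε, hεM⟩
    have hεM' : ε * M ≤ 1 / 2 := by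
      rw [lt_div_iff₀ (by positivity)] at hεM; linarith
    have hlin : ∀ {g : (∀ j, 𝒳 j) → ℝ}, IsBddMeas g → IsBddMeas (fun x => 1 + ε * g x) :=
      fun hg => (IsBddMeas.const 1).add ((IsBddMeas.const ε).mul hg)
    have hent := h.ent_sq_le hσ (hlin hf) (fun i => hlin (hm i))
      (fun i x y => by simp only [hmi])
    have hD : ∫ x, ∑ i, (1 + ε * f x - (1 + ε * m i x)) ^ 2 ∂μ = ε ^ 2 * D := by
      rw [← integral_const_mul]
      refine integral_congr_ae (.of_forall fun x => ?_)
      simp only [Finset.mul_sum]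
      exact Finset.sum_congr rfl fun i _ => by ring
    have hS : ∫ x, (1 + ε * f x) ^ 2 ∂μ = 1 + ε ^ 2 * v := by
      have : ∀ x, (1 + ε * f x) ^ 2 = 1 + 2 * ε * f x + ε ^ 2 * f x ^ 2 := fun x => by ring
      simp only [this]
      rw [hf.integral_quadratic, hf0]
      ring
    have hv : 0 ≤ v := integral_nonneg fun x => sq_nonneg _
    have hlog : Real.log (1 + ε ^ 2 * v) ≤ ε ^ 2 * v := by
      have := Real.log_le_sub_one_of_pos (x := 1 + ε ^ 2 * v) (by positivity)
      linarith
    have hlow : (3 - 10 * M * ε) * ε ^ 2 * v ≤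
        ∫ x, (1 + ε * f x) ^ 2 * Real.log ((1 + ε * f x) ^ 2) ∂μ := by
      have h1 : (3 - 10 * M * ε) * ε ^ 2 * v =
          ∫ x, (0 + 2 * ε * f x + (3 - 10 * M * ε) * ε ^ 2 * f x ^ 2) ∂μ := by
        rw [hf.integral_quadratic, hf0]
        ring
      rw [h1]
      refine integral_mono ((((IsBddMeas.const 0).add ((IsBddMeas.const (2 * ε)).mul hf)).add
        ((IsBddMeas.const ((3 - 10 * M * ε) * ε ^ 2)).mul (hf.pow 2))).integrable μ)
        ((((hlin hf).pow 2).continuous_comp Real.continuous_mul_log).integrable μ) fun x => ?_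
      have hsM : |ε * f x| ≤ ε * M := by
        rw [abs_mul, abs_of_pos hε]
        exact mul_le_mul_of_nonneg_left (hM x) hε.le
      refine le_trans ?_ (sq_mul_log_sq_lower (hsM.trans hεM'))
      have : |ε * f x| ^ 3 ≤ ε * M * (ε * f x) ^ 2 := by
        rw [pow_succ', sq_abs]
        exact mul_le_mul_of_nonneg_right hsM (sq_nonneg _)
      nlinarith
    rw [ent, hD, hS] at hent
    have h2 := mul_le_mul_of_nonneg_left hlog (show 0 ≤ 1 + ε ^ 2 * v by positivity)
    have h3 : ε ^ 2 * ((2 - 10 * M * ε) * v - ε ^ 2 * v ^ 2) ≤ ε ^ 2 * (2 * σ2 * D) := by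
      nlinarith
    exact le_of_mul_le_mul_left h3 (by positivity)
  have hlim : Tendsto (fun ε : ℝ => (2 - 10 * M * ε) * v - ε ^ 2 * v ^ 2)
      (nhdsWithin 0 (Set.Ioi 0)) (nhds (2 * v)) := by
    have : Continuous (fun ε : ℝ => (2 - 10 * M * ε) * v - ε ^ 2 * v ^ 2) := by fun_prop
    simpa using (this.tendsto 0).mono_left nhdsWithin_le_nhds
  have := le_of_tendsto hlim (Filter.eventually_of_mem
    (Ioo_mem_nhdsGT (by positivity : (0 : ℝ) < 1 / (2 * M))) key)
  linarith

lemma rpow_sub_rpow_le {r u v : ℝ} (hr : 1 ≤ r) (hv : 0 ≤ v) (hu : 0 < u) :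
    u ^ r - v ^ r ≤ r * u ^ (r - 1) * (u - v) := by
  have h := one_add_mul_self_le_rpow_one_add (s := v / u - 1)
    (by have := div_nonneg hv hu.le; linarith) hr
  rw [add_sub_cancel, Real.div_rpow hv hu.le, le_div_iff₀ (by positivity)] at h
  have h2 : u ^ r = u ^ (r - 1) * u := by
    rw [← Real.rpow_add_one hu.ne', sub_add_cancel]
  have h3 : (1 + r * (v / u - 1)) * u ^ r = u ^ r - r * u ^ (r - 1) * (u - v) := by
    rw [h2]; field_simp; ring
  linarith

lemma sq_rpow_sub_rpow_le {q u v : ℝ} (hq : 2 ≤ q) (hv : 0 ≤ v) (hvu : v ≤ u) (hu : 0 < u) :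
    (u ^ (q / 2) - v ^ (q / 2)) ^ 2 ≤ q ^ 2 / 4 * (u ^ (q - 2) * (u - v) ^ 2) := by
  have h1 := rpow_sub_rpow_le (r := q / 2) (by linarith) hv hu
  have h0 : 0 ≤ u ^ (q / 2) - v ^ (q / 2) :=
    sub_nonneg.2 (Real.rpow_le_rpow hv hvu (by linarith))
  refine (pow_le_pow_left₀ h0 h1 2).trans_eq ?_
  have : (u ^ (q / 2 - 1)) ^ 2 = u ^ (q - 2) := by
    rw [← Real.rpow_natCast, ← Real.rpow_mul hu.le]
    congr 1; push_cast; ring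
  rw [mul_pow, mul_pow, this]; ring

lemma DLSI.lpN_sq_le_of_pos (h : DLSI μ ν σ2) (hσ : 0 ≤ σ2) {f G : (∀ j, 𝒳 j) → ℝ}
    (hf : IsBddMeas f) {δ : ℝ} (hδ : 0 < δ) (hfδ : ∀ x, δ ≤ f x) (hG : IsBddMeas G)
    {m : Fin n → (∀ j, 𝒳 j) → ℝ}
    (hm : ∀ i, IsBddMeas (m i)) (hmi : ∀ i x y, m i (Function.update x i y) = m i x)
    (hm0 : ∀ i x, 0 ≤ m i x) (hmf : ∀ i x, m i x ≤ f x)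
    (hGm : ∀ x, ∑ i, (f x - m i x) ^ 2 ≤ G x ^ 2) {p : ℝ} (hp : 2 ≤ p) :
    lpN μ p f ^ 2 ≤ lpN μ 2 f ^ 2 + σ2 * (p - 2) * lpN μ p G ^ 2 := by
  have hfpos : ∀ x, 0 < f x := fun x => hδ.trans_le (hfδ x)
  set X : (∀ j, 𝒳 j) → ℝ := fun x => Real.log (f x)
  have hfX : ∀ (q : ℝ) x, f x ^ q = Real.exp (q * X x) := fun q x => by
    rw [Real.rpow_def_of_pos (hfpos x), mul_comm]
  have hX : IsBddMeas X := by
    obtain ⟨M, hM⟩ := hf.2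
    refine ⟨hf.1.log, max |Real.log δ| |Real.log M|, fun x => abs_le_max_abs_abs ?_ ?_⟩
    · exact Real.log_le_log hδ (hfδ x)
    · exact Real.log_le_log (hfpos x) ((le_abs_self _).trans (hM x))
  have hexp : ∀ q : ℝ, IsBddMeas (fun x => Real.exp (q * X x)) := fun q =>
    ((IsBddMeas.const q).mul hX).continuous_comp Real.continuous_exp
  set S := ProbabilityTheory.mgf X μ
  have hSint : ∀ q, S q = ∫ x, f x ^ q ∂μ := fun q => by
    simp only [hfX]; rfl
  have hSpos : ∀ q, 0 < S q := fun q => ProbabilityTheory.mgf_pos ((hexp q).integrable μ)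
  have hset : ProbabilityTheory.integrableExpSet X μ = Set.univ :=
    Set.eq_univ_of_forall fun q => (hexp q).integrable μ
  have hSd : ∀ q, HasDerivAt S (∫ x, X x * Real.exp (q * X x) ∂μ) q := fun q =>
    ProbabilityTheory.hasDerivAt_mgf (by simp [hset])
  set φ : ℝ → ℝ := fun q => Real.exp (2 / q * Real.log (S q))
  have hφ : ∀ q, φ q = S q ^ (2 / q) := fun q => by
    rw [Real.rpow_def_of_pos (hSpos q), mul_comm]
  have hφl : ∀ q, 0 < q → φ q = lpN μ q f ^ 2 := fun q hq => by
    rw [hφ, hSint, lpN, ← Real.rpow_natCast, ← Real.rpow_mul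
      (integral_nonneg fun _ => by positivity)]
    simp only [abs_of_pos (hfpos _)]
    congr 1; push_cast; ring
  have hφd : ∀ q, 0 < q → HasDerivAt φ (φ q * (-2 / q ^ 2 * Real.log (S q) +
      2 / q * ((∫ x, X x * Real.exp (q * X x) ∂μ) / S q))) q := fun q hq => by
    have h1 : HasDerivAt (fun q : ℝ => 2 / q) (-2 / q ^ 2) q := by
      simpa using! (hasDerivAt_const q (2 : ℝ)).div (hasDerivAt_id q) hq.ne'
    exact (h1.mul ((hSd q).log (hSpos q).ne')).exp
  have hbound : ∀ q ∈ Set.Ioo 2 p, φ q * (-2 / q ^ 2 * Real.log (S q) +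
      2 / q * ((∫ x, X x * Real.exp (q * X x) ∂μ) / S q)) ≤ σ2 * lpN μ p G ^ 2 := by
    rintro q ⟨hq2, hqp⟩
    have hq0 : 0 < q := by linarith
    have hent := h.ent_sq_le hσ (hf.rpow (r := q / 2) (by positivity))
      (fun i => (hm i).rpow (r := q / 2) (by positivity)) (fun i x y => by simp only [hmi])
    have hsq : ∀ x, (f x ^ (q / 2)) ^ 2 = f x ^ q := fun x => by
      rw [← Real.rpow_natCast, ← Real.rpow_mul (hfpos x).le]
      congr 1; push_cast; ring
    have hentS : ent μ (fun x => (f x ^ (q / 2)) ^ 2) =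
        q * (∫ x, X x * Real.exp (q * X x) ∂μ) - S q * Real.log (S q) := by
      simp only [hsq, ent, ← hSint]
      rw [← integral_const_mul]
      congr 1
      refine integral_congr_ae (.of_forall fun x => ?_)
      simp only [hfX, Real.log_exp]; ring
    have hfq := hf.rpow (r := q - 2) (by linarith)
    have hint : ∫ x, ∑ i, (f x ^ (q / 2) - m i x ^ (q / 2)) ^ 2 ∂μ ≤
        q ^ 2 / 4 * ∫ x, f x ^ (q - 2) * G x ^ 2 ∂μ := by
      rw [← integral_const_mul]
      refine integral_mono_of_nonneg (.of_forall fun x => Finset.sum_nonneg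
        fun i _ => sq_nonneg _) (((hfq.mul (hG.pow 2)).integrable μ).const_mul _)
        (.of_forall fun x => ?_)
      refine (Finset.sum_le_sum fun i _ =>
        sq_rpow_sub_rpow_le hq2.le (hm0 i x) (hmf i x) (hfpos x)).trans ?_
      rw [← Finset.mul_sum, ← Finset.mul_sum]
      exact mul_le_mul_of_nonneg_left (mul_le_mul_of_nonneg_left (hGm x)
        (Real.rpow_nonneg (hfpos x).le _)) (by positivity)
    have hhold : ∫ x, f x ^ (q - 2) * G x ^ 2 ∂μ ≤ S q ^ (1 - 2 / q) * lpN μ q G ^ 2 := by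
      have hconj : (q / (q - 2)).HolderConjugate (q / 2) := by
        rw [Real.holderConjugate_iff]
        constructor
        · rw [lt_div_iff₀ (by linarith)]; linarith
        · field_simp; ring
      have hq2' : q - 2 ≠ 0 := by linarith
      refine (integral_mul_le_Lp_mul_Lq_of_nonneg hconj
        (.of_forall fun x => Real.rpow_nonneg (hfpos x).le _)
        (.of_forall fun x => sq_nonneg (G x)) (hfq.memLp _ _)
        ((hG.pow 2).memLp _ _)).trans_eq ?_
      congr 1
      · rw [hSint]
        congr 1
        · refine integral_congr_ae (.of_forall fun x => ?_)
          simp only [← Real.rpow_mul (hfpos x).le]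
          congr 1; field_simp
        · field_simp
      · rw [lpN, ← Real.rpow_natCast, ← Real.rpow_mul (integral_nonneg fun _ => by positivity)]
        congr 1
        · refine integral_congr_ae (.of_forall fun x => ?_)
          simp only
          rw [← sq_abs, ← Real.rpow_natCast, ← Real.rpow_mul (abs_nonneg _)]
          congr 1; push_cast; field_simp
        · push_cast; field_simp
    have hmono : lpN μ q G ^ 2 ≤ lpN μ p G ^ 2 :=
      pow_le_pow_left₀ (lpN_nonneg _ _ _) (lpN_mono_exponent hq0 hqp.le hG) 2
    rw [hentS] at hent
    have hS := hSpos q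
    have hSq : S q ^ (2 / q) * S q ^ (1 - 2 / q) = S q := by
      rw [← Real.rpow_add hS]; simp
    calc φ q * (-2 / q ^ 2 * Real.log (S q) +
          2 / q * ((∫ x, X x * Real.exp (q * X x) ∂μ) / S q))
        = 2 / q ^ 2 * (S q ^ (2 / q) / S q) * (q * (∫ x, X x * Real.exp (q * X x) ∂μ) -
            S q * Real.log (S q)) := by
          rw [hφ]; field_simp; ring
      _ ≤ 2 / q ^ 2 * (S q ^ (2 / q) / S q) * (2 * σ2 * (q ^ 2 / 4 *
            (S q ^ (1 - 2 / q) * lpN μ p G ^ 2))) := by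
          refine mul_le_mul_of_nonneg_left (hent.trans ?_) (by positivity)
          refine mul_le_mul_of_nonneg_left (hint.trans ?_) (by positivity)
          refine mul_le_mul_of_nonneg_left (hhold.trans ?_) (by positivity)
          exact mul_le_mul_of_nonneg_left hmono (by positivity)
      _ = σ2 * (S q ^ (2 / q) * S q ^ (1 - 2 / q) / S q) * lpN μ p G ^ 2 := by
          field_simp; ring
      _ = σ2 * lpN μ p G ^ 2 := by rw [hSq, div_self hS.ne', mul_one]
  have hmv := (convex_Icc (2 : ℝ) p).image_sub_le_mul_sub_of_deriv_le (f := φ)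
    (fun q hq => (hφd q (by linarith [hq.1])).continuousAt.continuousWithinAt)
    (fun q hq => (hφd q (by
      rw [interior_Icc] at hq; linarith [hq.1])).differentiableAt.differentiableWithinAt)
    (C := σ2 * lpN μ p G ^ 2) (fun q hq => by
      rw [interior_Icc] at hq
      rw [(hφd q (by linarith [hq.1])).deriv]
      exact hbound q hq) 2 ⟨le_rfl, hp⟩ p ⟨hp, le_rfl⟩ hp
  rw [hφl p (by linarith), hφl 2 two_pos] at hmv
  linarith

/-- Moment inequality for the positive part of a centered function under a `𝔡`-LSI. -/
lemma DLSI.lpN_posPart_le (h : DLSI μ ν σ2) (hσ : 0 ≤ σ2) {f G : (∀ j, 𝒳 j) → ℝ}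
    (hf : IsBddMeas f) (hG : IsBddMeas G) {m : Fin n → (∀ j, 𝒳 j) → ℝ}
    (hm : ∀ i, IsBddMeas (m i)) (hmi : ∀ i x y, m i (Function.update x i y) = m i x)
    (hmf : ∀ i x, m i x ≤ f x)
    (hGm : ∀ x, ∑ i, (f x - m i x) ^ 2 ≤ G x ^ 2) {p : ℝ} (hp : 2 ≤ p) :
    lpN μ p (fun x => max (f x - ∫ y, f y ∂μ) 0) ^ 2 ≤ σ2 * (p - 1) * lpN μ p G ^ 2 := by
  set c := ∫ y, f y ∂μ
  set g : (∀ j, 𝒳 j) → ℝ := fun x => max (f x - c) 0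
  have hfc : IsBddMeas (fun x => f x - c) := hf.sub (.const c)
  have hg : IsBddMeas g := hfc.posPart
  have hg0 : ∀ x, 0 ≤ g x := fun x => le_max_right _ _
  have hvar : ∫ x, g x ^ 2 ∂μ ≤ σ2 * lpN μ p G ^ 2 := by
    calc ∫ x, g x ^ 2 ∂μ ≤ ∫ x, (f x - c) ^ 2 ∂μ := by
          refine integral_mono ((hg.pow 2).integrable μ) ((hfc.pow 2).integrable μ) fun x => ?_
          rw [← sq_abs (f x - c)]
          exact pow_le_pow_left₀ (hg0 x) (max_le (le_abs_self _) (abs_nonneg _)) 2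
      _ ≤ σ2 * ∫ x, ∑ i, (f x - c - (m i x - c)) ^ 2 ∂μ := by
          refine h.integral_sq_le hσ hfc ?_ (fun i => (hm i).sub (.const c))
            (fun i x y => by simp only [hmi])
          rw [integral_sub (hf.integrable μ) (integrable_const _)]
          simp [c]
      _ ≤ σ2 * ∫ x, G x ^ 2 ∂μ := by
          refine mul_le_mul_of_nonneg_left (integral_mono_of_nonneg (.of_forall fun x =>
            Finset.sum_nonneg fun i _ => sq_nonneg _) ((hG.pow 2).integrable μ)
            (.of_forall fun x => ?_)) hσ
          simpa using hGm x
      _ ≤ σ2 * lpN μ p G ^ 2 := by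
          rw [← lpN_two_sq]
          exact mul_le_mul_of_nonneg_left (pow_le_pow_left₀ (lpN_nonneg _ _ _)
            (lpN_mono_exponent two_pos hp hG) 2) hσ
  have key : ∀ δ ∈ Set.Ioi (0 : ℝ), lpN μ p g ^ 2 ≤
      σ2 * (p - 1) * lpN μ p G ^ 2 + (2 * δ * ∫ x, g x ∂μ) + δ ^ 2 := by
    intro δ hδ
    have hδ0 : 0 < δ := hδ
    have hF : IsBddMeas (fun x => g x + δ) := hg.add (.const δ)
    have h1 := h.lpN_sq_le_of_pos hσ hF hδ (fun x => by linarith [hg0 x]) hG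
      (m := fun i x => max (m i x - c) 0 + δ)
      (fun i => ((hm i).sub (.const c)).posPart.add (.const δ))
      (fun i x y => by simp only [hmi])
      (fun i x => by positivity)
      (fun i x => by
        have := max_le_max_right 0 (sub_le_sub_right (hmf i x) c)
        simpa [g] using this)
      (fun x => le_trans (Finset.sum_le_sum fun i _ => by
        refine sq_le_sq.2 ?_
        simpa [g] using abs_max_sub_max_le_abs (f x - c) (m i x - c) 0) (hGm x)) hp
    have h2 : lpN μ p g ≤ lpN μ p (fun x => g x + δ) :=
      lpN_mono (by linarith) hg hF fun x => by
        rw [abs_of_nonneg (hg0 x), abs_of_nonneg (by linarith [hg0 x])]; linarith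
    have h3 := pow_le_pow_left₀ (lpN_nonneg _ _ _) h2 2
    have h4 : lpN μ 2 (fun x => g x + δ) ^ 2 =
        ∫ x, g x ^ 2 ∂μ + (2 * δ * ∫ x, g x ∂μ) + δ ^ 2 := by
      rw [lpN_two_sq]
      have : ∀ x, (g x + δ) ^ 2 = δ ^ 2 + 2 * δ * g x + 1 * g x ^ 2 := fun x => by ring
      simp only [this]
      rw [hg.integral_quadratic]
      ring
    nlinarith
  have hlim : Tendsto (fun δ : ℝ => σ2 * (p - 1) * lpN μ p G ^ 2 + (2 * δ * ∫ x, g x ∂μ) +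
      δ ^ 2) (nhdsWithin 0 (Set.Ioi 0)) (nhds (σ2 * (p - 1) * lpN μ p G ^ 2)) := by
    have : Continuous (fun δ : ℝ => σ2 * (p - 1) * lpN μ p G ^ 2 + (2 * δ * ∫ x, g x ∂μ) +
      δ ^ 2) := by fun_prop
    simpa using (this.tendsto 0).mono_left nhdsWithin_le_nhds
  exact ge_of_tendsto hlim (Filter.eventually_of_mem self_mem_nhdsWithin key)

end LogSobolev

section Chaos

variable {n d k : ℕ} {B : Type*} [NormedAddCommGroup B] [NormedSpace ℝ B]

lemma chaosPartial_update_of_mem (t : IdxSet n d → B) (x : Fin n → ℝ) {i : Fin n} (y : ℝ)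
    {idx : Fin k → Fin n} (hi : i ∈ Set.range idx) :
    chaosPartial t (Function.update x i y) idx = chaosPartial t x idx := by
  obtain ⟨s, rfl⟩ := hi
  refine Finset.sum_congr rfl fun I hI => ?_
  rw [Finset.prod_update_of_notMem ((Finset.mem_filter.1 hI).2.2 s)]

lemma chaosPartial_sub_update (hk : k + 1 ≤ d) (t : IdxSet n d → B) (x : Fin n → ℝ)
    {i : Fin n} (y : ℝ) {idx : Fin k → Fin n} (hi : i ∉ Set.range idx) :
    chaosPartial t x idx - chaosPartial t (Function.update x i y) idx =
      (x i - y) • chaosPartial t x (Fin.cons i idx : Fin (k + 1) → Fin n) := by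
  set T : Finset (Fin n) → B := fun J => if h : J.card = d then t ⟨J, h⟩ else 0 with hT
  have himg : Finset.image (Fin.cons i idx : Fin (k + 1) → Fin n) Finset.univ =
      insert i (Finset.image idx Finset.univ) := by
    ext j; simp [Fin.exists_fin_succ, eq_comm]
  have hexp : ∀ {l : ℕ} (z : Fin n → ℝ) (idx' : Fin l → Fin n), chaosPartial t z idx' =
      ∑ I ∈ Finset.univ.filter (fun I : Finset (Fin n) => I.card = d - l ∧ ∀ s, idx' s ∉ I),
        (∏ j ∈ I, z j) • T (I ∪ Finset.image idx' Finset.univ) := fun _ _ => rfl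
  rw [hexp, hexp, hexp, ← Finset.sum_sub_distrib, Finset.smul_sum,
    ← Finset.sum_filter_add_sum_filter_not _ (fun I => i ∈ I)]
  have hz : ∑ I ∈ (Finset.univ.filter (fun I : Finset (Fin n) =>
      I.card = d - k ∧ ∀ s, idx s ∉ I)).filter (fun I => ¬ i ∈ I),
      ((∏ j ∈ I, x j) • T (I ∪ Finset.image idx Finset.univ) -
        (∏ j ∈ I, Function.update x i y j) • T (I ∪ Finset.image idx Finset.univ)) = 0 := by
    refine Finset.sum_eq_zero fun I hI => ?_
    rw [Finset.prod_update_of_notMem (Finset.mem_filter.1 hI).2, sub_self]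
  rw [hz, add_zero]
  refine Finset.sum_nbij' (fun I => I.erase i) (fun I => insert i I) ?_ ?_ ?_ ?_ ?_
  · intro I hI
    simp only [Finset.mem_filter, Finset.mem_univ, true_and] at hI ⊢
    obtain ⟨⟨hc, hs⟩, hiI⟩ := hI
    refine ⟨by rw [Finset.card_erase_of_mem hiI, hc]; omega, fun s => ?_⟩
    refine Fin.cases ?_ (fun s => ?_) s
    · simp
    · simp [hs s]
  · intro I hI
    simp only [Finset.mem_filter, Finset.mem_univ, true_and] at hI ⊢
    obtain ⟨hc, hs⟩ := hI
    have h0 : i ∉ I := by simpa using hs 0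
    refine ⟨⟨by rw [Finset.card_insert_of_notMem h0, hc]; omega, fun s => ?_⟩,
      Finset.mem_insert_self _ _⟩
    have h1 : idx s ∉ I := by simpa using hs s.succ
    have h2 : idx s ≠ i := fun h => hi ⟨s, h⟩
    simp [h1, h2]
  · intro I hI
    exact Finset.insert_erase (Finset.mem_filter.1 hI).2
  · intro I hI
    have h0 : i ∉ I := by simpa using (Finset.mem_filter.1 hI).2.2 0
    exact Finset.erase_insert h0
  · intro I hI
    have hiI := (Finset.mem_filter.1 hI).2
    rw [← sub_smul, smul_smul, himg, ← Finset.mul_prod_erase I _ hiI,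
      ← Finset.mul_prod_erase I (Function.update x i y) hiI,
      Finset.prod_update_of_notMem (Finset.notMem_erase i I), Function.update_self, ← sub_mul]
    congr 2
    ext j
    by_cases hj : j = i
    · simp [hj, hiI]
    · simp [hj]

lemma chaosPartial_self (t : IdxSet n d → B) (x x' : Fin n → ℝ) (idx : Fin d → Fin n) :
    chaosPartial t x idx = chaosPartial t x' idx := by
  refine Finset.sum_congr rfl fun I hI => ?_
  have : I = ∅ := by simpa using (Finset.mem_filter.1 hI).2.1
  simp [this]

lemma chaosPartial_zero (t : IdxSet n d → B) (x : Fin n → ℝ) (idx : Fin 0 → Fin n) :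
    chaosPartial t x idx = chaosSum t x := by
  unfold chaosPartial chaosSum
  refine Finset.sum_bij' (fun I hI => (⟨I, by simpa using hI⟩ : IdxSet n d))
    (fun S _ => S.1) ?_ ?_ ?_ ?_ ?_
  · exact fun I hI => Finset.mem_univ _
  · intro S _
    simpa using S.2
  · simp
  · intro S _
    rfl
  · intro I hI
    have hI' : I.card = d := by simpa using hI
    simp [hI']

@[fun_prop]
lemma continuous_chaosPartial (idx : Fin k → Fin n) :
    Continuous (fun q : (IdxSet n d → B) × (Fin n → ℝ) => chaosPartial q.1 q.2 idx) := by
  unfold chaosPartial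
  refine continuous_finsetSum _ fun I _ => Continuous.smul (by fun_prop) ?_
  split_ifs <;> fun_prop

/-- The `k`-linear form in `α` whose suprema define `W_k`. -/
def chaosForm (t : IdxSet n d → B) (α : Fin k → Fin n → ℝ) (x : Fin n → ℝ) : B :=
  ∑ idx ∈ Finset.univ.filter (fun idx : Fin k → Fin n => Function.Injective idx),
    (∏ j, α j (idx j)) • chaosPartial t x idx

lemma continuous_chaosForm :
    Continuous (fun q : ((IdxSet n d → B) × (Fin n → ℝ)) × (Fin k → Fin n → ℝ) =>
      chaosForm q.1.1 q.2 q.1.2) := by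
  unfold chaosForm
  refine continuous_finsetSum _ fun idx _ => Continuous.smul (by fun_prop) ?_
  exact (continuous_chaosPartial idx).comp continuous_fst

lemma chaosForm_self (t : IdxSet n d → B) (α : Fin d → Fin n → ℝ) (x x' : Fin n → ℝ) :
    chaosForm t α x = chaosForm t α x' :=
  Finset.sum_congr rfl fun idx _ => by rw [chaosPartial_self t x x']

/-- The discrete partial derivative of `chaosForm` in the coordinate `i`. -/
def chaosFormDeriv (t : IdxSet n d → B) (α : Fin k → Fin n → ℝ) (x : Fin n → ℝ)
    (i : Fin n) : B :=
  ∑ idx : Fin k → Fin n, if i ∉ Set.range idx ∧ Function.Injective idx then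
    (∏ j, α j (idx j)) • chaosPartial t x (Fin.cons i idx : Fin (k + 1) → Fin n) else 0

lemma chaosForm_sub_update (hk : k + 1 ≤ d) (t : IdxSet n d → B) (α : Fin k → Fin n → ℝ)
    (x : Fin n → ℝ) (i : Fin n) (y : ℝ) :
    chaosForm t α x - chaosForm t α (Function.update x i y) =
      (x i - y) • chaosFormDeriv t α x i := by
  rw [chaosForm, chaosForm, chaosFormDeriv, ← Finset.sum_sub_distrib, Finset.sum_filter,
    Finset.smul_sum]
  refine Finset.sum_congr rfl fun idx _ => ?_
  by_cases hinj : Function.Injective idx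
  · by_cases hi : i ∈ Set.range idx
    · rw [chaosPartial_update_of_mem t x y hi]
      simp only [sub_self, ite_self, hi, not_true_eq_false, false_and, if_false, smul_zero]
    · rw [if_pos hinj, if_pos ⟨hi, hinj⟩, ← smul_sub, chaosPartial_sub_update hk t x y hi,
        smul_comm]
  · simp [hinj]

lemma sum_smul_chaosFormDeriv (t : IdxSet n d → B) (α : Fin k → Fin n → ℝ) (x : Fin n → ℝ)
    (β : Fin n → ℝ) :
    ∑ i, β i • chaosFormDeriv t α x i =
      chaosForm t (Fin.cons β α : Fin (k + 1) → Fin n → ℝ) x := by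
  rw [chaosForm, Finset.sum_filter, ← (Fin.consEquiv fun _ : Fin (k + 1) => Fin n).sum_comp,
    Fintype.sum_prod_type]
  refine Finset.sum_congr rfl fun i _ => ?_
  rw [chaosFormDeriv, Finset.smul_sum]
  refine Finset.sum_congr rfl fun idx _ => ?_
  have hc : (Fin.consEquiv fun _ : Fin (k + 1) => Fin n) (i, idx) = Fin.cons i idx := rfl
  rw [hc]
  simp only [Fin.cons_injective_iff]
  split_ifs
  · rw [smul_smul, Fin.prod_univ_succ]
    simp
  · simp

/-- The tuples of `k` vectors in the Euclidean unit ball. -/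
def unitTuples (n k : ℕ) : Set (Fin k → Fin n → ℝ) := {α | ∀ j, ∑ i, α j i ^ 2 ≤ 1}

lemma isCompact_unitTuples (n k : ℕ) : IsCompact (unitTuples n k) := by
  have hbox : IsCompact (Set.univ.pi fun _ : Fin k => Set.univ.pi fun _ : Fin n =>
      Set.Icc (-1 : ℝ) 1) :=
    isCompact_univ_pi fun _ => isCompact_univ_pi fun _ => isCompact_Icc
  refine hbox.of_isClosed_subset ?_ fun α hα j _ i _ => ?_
  · have : unitTuples n k = ⋂ j, {α | ∑ i, α j i ^ 2 ≤ 1} := by ext; simp [unitTuples]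
    rw [this]
    exact isClosed_iInter fun j => isClosed_le (by fun_prop) continuous_const
  · have h1 : α j i ^ 2 ≤ 1 :=
      (Finset.single_le_sum (f := fun i => α j i ^ 2) (fun _ _ => sq_nonneg _)
        (Finset.mem_univ i)).trans (hα j)
    exact abs_le.1 (abs_le_one_iff_mul_self_le_one.2 (by nlinarith))

lemma zero_mem_unitTuples (n k : ℕ) : (0 : Fin k → Fin n → ℝ) ∈ unitTuples n k := fun j => by
  simp

variable {𝒯 : Set (IdxSet n d → B)}

lemma Wfun_eq_sSup (𝒯 : Set (IdxSet n d → B)) (k : ℕ) (x : Fin n → ℝ) :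
    Wfun 𝒯 k x = sSup ((fun t => sSup ((fun α : Fin k → Fin n → ℝ =>
      ‖chaosForm t α x‖) '' unitTuples n k)) '' 𝒯) := by
  rw [sSup_image']
  simp only [sSup_image']
  rfl

lemma continuous_sSup_chaosForm :
    Continuous (fun q : (IdxSet n d → B) × (Fin n → ℝ) =>
      sSup ((fun α : Fin k → Fin n → ℝ => ‖chaosForm q.1 α q.2‖) '' unitTuples n k)) :=
  (isCompact_unitTuples n k).continuous_sSup
    (f := fun (q : (IdxSet n d → B) × (Fin n → ℝ)) α => ‖chaosForm q.1 α q.2‖)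
    (show Continuous fun q : ((IdxSet n d → B) × (Fin n → ℝ)) × (Fin k → Fin n → ℝ) =>
      ‖chaosForm q.1.1 q.2 q.1.2‖ from continuous_chaosForm.norm)

lemma continuous_Wfun (h𝒯 : IsCompact 𝒯) (k : ℕ) : Continuous (Wfun 𝒯 k) := by
  obtain ⟨S, hS⟩ : ∃ S : (IdxSet n d → B) × (Fin n → ℝ) → ℝ, S = fun q =>
      sSup ((fun α : Fin k → Fin n → ℝ => ‖chaosForm q.1 α q.2‖) '' unitTuples n k) := ⟨_, rfl⟩
  have hSc : Continuous S := hS ▸ continuous_sSup_chaosForm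
  have hSW : Wfun 𝒯 k = fun x => sSup ((fun t => S (t, x)) '' 𝒯) := by
    rw [hS]
    exact funext (Wfun_eq_sSup 𝒯 k)
  rw [hSW]
  exact h𝒯.continuous_sSup (f := fun x t => S (t, x)) (hSc.comp continuous_swap)

lemma continuous_chaosForm_right (t : IdxSet n d → B) (x : Fin n → ℝ) :
    Continuous (fun α : Fin k → Fin n → ℝ => ‖chaosForm t α x‖) :=
  (continuous_chaosForm.comp (by fun_prop :
    Continuous fun α : Fin k → Fin n → ℝ => ((t, x), α))).norm

lemma norm_chaosForm_le_Wfun (h𝒯 : IsCompact 𝒯) {t : IdxSet n d → B} (ht : t ∈ 𝒯)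
    {α : Fin k → Fin n → ℝ} (hα : α ∈ unitTuples n k) (x : Fin n → ℝ) :
    ‖chaosForm t α x‖ ≤ Wfun 𝒯 k x := by
  rw [Wfun_eq_sSup]
  refine le_trans ?_ (le_csSup (h𝒯.image (continuous_sSup_chaosForm.comp (by fun_prop :
    Continuous fun t : IdxSet n d → B => (t, x)))).bddAbove (Set.mem_image_of_mem _ ht))
  exact le_csSup ((isCompact_unitTuples n k).image (continuous_chaosForm_right t x)).bddAbove
    (Set.mem_image_of_mem _ hα)

lemma exists_Wfun_eq (h𝒯 : IsCompact 𝒯) (h𝒯ne : 𝒯.Nonempty) (k : ℕ) (x : Fin n → ℝ) :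
    ∃ t ∈ 𝒯, ∃ α ∈ unitTuples n k, Wfun 𝒯 k x = ‖chaosForm t α x‖ := by
  obtain ⟨t, ht, h1⟩ := h𝒯.exists_sSup_image_eq h𝒯ne (continuous_sSup_chaosForm.comp
    (by fun_prop : Continuous fun t : IdxSet n d → B => (t, x))).continuousOn
  obtain ⟨α, hα, h2⟩ := (isCompact_unitTuples n k).exists_sSup_image_eq
    ⟨0, zero_mem_unitTuples n k⟩ (continuous_chaosForm_right t x).continuousOn
  exact ⟨t, ht, α, hα, (Wfun_eq_sSup 𝒯 k x).trans (h1.trans h2)⟩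

lemma Wfun_nonneg (𝒯 : Set (IdxSet n d → B)) (k : ℕ) (x : Fin n → ℝ) : 0 ≤ Wfun 𝒯 k x :=
  Real.iSup_nonneg fun _ => Real.iSup_nonneg fun _ => norm_nonneg _

lemma Wfun_zero (𝒯 : Set (IdxSet n d → B)) : Wfun 𝒯 0 = fSup 𝒯 := by
  funext x
  unfold Wfun fSup
  refine iSup_congr fun t => ?_
  have : Nonempty {α : Fin 0 → Fin n → ℝ // ∀ j, ∑ i, α j i ^ 2 ≤ 1} :=
    ⟨⟨0, zero_mem_unitTuples n 0⟩⟩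
  simp [chaosPartial_zero, Function.injective_of_subsingleton]

lemma Wfun_self (𝒯 : Set (IdxSet n d → B)) (x x' : Fin n → ℝ) :
    Wfun 𝒯 d x = Wfun 𝒯 d x' := by
  rw [Wfun_eq_sSup, Wfun_eq_sSup]
  simp only [chaosForm_self _ _ x x']

lemma sum_sq_Wfun_sub_update_le (h𝒯 : IsCompact 𝒯) (h𝒯ne : 𝒯.Nonempty) (hk : k + 1 ≤ d)
    {a b : ℝ} {x y : Fin n → ℝ} (hx : ∀ i, x i ∈ Set.Icc a b) (hy : ∀ i, y i ∈ Set.Icc a b)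
    (hle : ∀ i, Wfun 𝒯 k (Function.update x i (y i)) ≤ Wfun 𝒯 k x) :
    ∑ i, (Wfun 𝒯 k x - Wfun 𝒯 k (Function.update x i (y i))) ^ 2 ≤
      ((b - a) * Wfun 𝒯 (k + 1) x) ^ 2 := by
  obtain ⟨t, ht, α, hα, hW⟩ := exists_Wfun_eq h𝒯 h𝒯ne k x
  obtain ⟨v, hv1, hv⟩ := exists_dual_vector'' ℝ (chaosForm t α x)
  have hvle : ∀ z, v z ≤ ‖z‖ := fun z =>
    (le_abs_self _).trans ((v.le_of_opNorm_le hv1 z).trans_eq (one_mul _))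
  set w : Fin n → ℝ := fun i => v (chaosFormDeriv t α x i)
  set s := ∑ i, w i ^ 2 with hs
  have hs0 : 0 ≤ s := Finset.sum_nonneg fun _ _ => sq_nonneg _
  have hterm : ∀ i, (Wfun 𝒯 k x - Wfun 𝒯 k (Function.update x i (y i))) ^ 2 ≤
      (b - a) ^ 2 * w i ^ 2 := by
    intro i
    have h1 := norm_chaosForm_le_Wfun h𝒯 ht hα (Function.update x i (y i))
    have h2 : v (chaosForm t α x) - v (chaosForm t α (Function.update x i (y i))) =
        (x i - y i) * w i := by
      rw [← map_sub, chaosForm_sub_update hk, map_smul, smul_eq_mul]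
    have h3 := hvle (chaosForm t α (Function.update x i (y i)))
    have h4 : v (chaosForm t α x) = ‖chaosForm t α x‖ := hv
    have h5 : Wfun 𝒯 k x - Wfun 𝒯 k (Function.update x i (y i)) ≤ (x i - y i) * w i := by
      linarith
    refine (pow_le_pow_left₀ (sub_nonneg.2 (hle i)) h5 2).trans ?_
    rw [mul_pow]
    refine mul_le_mul_of_nonneg_right (sq_le_sq' ?_ ?_) (sq_nonneg _)
    · linarith [(hx i).1, (hy i).2]
    · linarith [(hx i).2, (hy i).1]
  have hsW : s ≤ Wfun 𝒯 (k + 1) x ^ 2 := by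
    rcases hs0.eq_or_lt with h0 | hpos
    · rw [← h0]; exact sq_nonneg _
    set β : Fin n → ℝ := fun i => w i / √s
    have hr : 0 < √s := Real.sqrt_pos.2 hpos
    have hβ : ∑ i, β i ^ 2 ≤ 1 := by
      simp only [β, div_pow, Real.sq_sqrt hs0, ← Finset.sum_div, ← hs]
      rw [div_self hpos.ne']
    have hmem : (Fin.cons β α : Fin (k + 1) → Fin n → ℝ) ∈ unitTuples n (k + 1) := fun j => by
      refine Fin.cases ?_ (fun j => ?_) j
      · simpa using hβ
      · simpa using hα j
    have h1 := (hvle _).trans (norm_chaosForm_le_Wfun h𝒯 ht hmem x)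
    rw [← sum_smul_chaosFormDeriv, map_sum] at h1
    have h2 : ∑ i, v (β i • chaosFormDeriv t α x i) = √s := by
      simp only [map_smul, smul_eq_mul]
      calc ∑ i, β i * w i = ∑ i, w i ^ 2 / √s :=
            Finset.sum_congr rfl fun i _ => by simp only [β]; ring
        _ = √s := by rw [← Finset.sum_div, ← hs, Real.div_sqrt]
    rw [h2] at h1
    calc s = √s ^ 2 := (Real.sq_sqrt hs0).symm
      _ ≤ _ := pow_le_pow_left₀ hr.le h1 2
  calc _ ≤ ∑ i, (b - a) ^ 2 * w i ^ 2 := Finset.sum_le_sum fun i _ => hterm i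
    _ = (b - a) ^ 2 * s := by rw [← Finset.mul_sum]
    _ ≤ _ := by
      rw [mul_pow]
      exact mul_le_mul_of_nonneg_left hsW (sq_nonneg _)

lemma Wtil_eq_sSup (𝒯 : Set (IdxSet n d → B)) (k : ℕ) (x : Fin n → ℝ) :
    Wtil 𝒯 k x = sSup ((fun α : Fin k → Fin n → ℝ =>
      ∑ idx ∈ Finset.univ.filter (fun idx : Fin k → Fin n => Function.Injective idx),
        (∏ j, α j (idx j)) * sSup ((fun t => ‖chaosPartial t x idx‖) '' 𝒯))
          '' unitTuples n k) := by
  rw [sSup_image']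
  simp only [sSup_image']
  rfl

lemma continuous_Wtil_aux (h𝒯 : IsCompact 𝒯) (k : ℕ) :
    Continuous (fun q : (Fin n → ℝ) × (Fin k → Fin n → ℝ) =>
      ∑ idx ∈ Finset.univ.filter (fun idx : Fin k → Fin n => Function.Injective idx),
        (∏ j, q.2 j (idx j)) * sSup ((fun t => ‖chaosPartial t q.1 idx‖) '' 𝒯)) := by
  refine continuous_finsetSum _ fun idx _ => Continuous.mul (by fun_prop) ?_
  exact (h𝒯.continuous_sSup (f := fun x t => ‖chaosPartial t x idx‖)
    ((continuous_chaosPartial idx).comp continuous_swap).norm).comp continuous_fst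

lemma continuous_Wtil (h𝒯 : IsCompact 𝒯) (k : ℕ) : Continuous (Wtil 𝒯 k) := by
  simp only [funext (Wtil_eq_sSup 𝒯 k)]
  exact (isCompact_unitTuples n k).continuous_sSup (f := fun x (α : Fin k → Fin n → ℝ) =>
    ∑ idx ∈ Finset.univ.filter (fun idx : Fin k → Fin n => Function.Injective idx),
      (∏ j, α j (idx j)) * sSup ((fun t => ‖chaosPartial t x idx‖) '' 𝒯))
    (continuous_Wtil_aux h𝒯 k)

lemma Wfun_le_Wtil (h𝒯 : IsCompact 𝒯) (h𝒯ne : 𝒯.Nonempty) (k : ℕ) (x : Fin n → ℝ) :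
    Wfun 𝒯 k x ≤ Wtil 𝒯 k x := by
  obtain ⟨t, ht, α, hα, hW⟩ := exists_Wfun_eq h𝒯 h𝒯ne k x
  have hα' : (fun j i => |α j i|) ∈ unitTuples n k := fun j => by simpa using hα j
  rw [hW, Wtil_eq_sSup]
  refine le_trans ?_ (le_csSup ((isCompact_unitTuples n k).image
    ((continuous_Wtil_aux h𝒯 k).comp (by fun_prop :
      Continuous fun α : Fin k → Fin n → ℝ => (x, α)))).bddAbove
    (Set.mem_image_of_mem _ hα'))
  refine (norm_sum_le _ _).trans (Finset.sum_le_sum fun idx _ => ?_)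
  rw [norm_smul, Real.norm_eq_abs, Finset.abs_prod]
  refine mul_le_mul_of_nonneg_left (le_csSup (h𝒯.image ((continuous_chaosPartial idx).comp
    (by fun_prop : Continuous fun t : IdxSet n d → B => (t, x))).norm).bddAbove
    (Set.mem_image_of_mem _ ht)) (Finset.prod_nonneg fun _ _ => abs_nonneg _)

end Chaos

section ClippedChaos

variable {n d : ℕ} {B : Type*} [NormedAddCommGroup B] [NormedSpace ℝ B]
  {𝒯 : Set (IdxSet n d → B)} {a b : ℝ} {μ : Measure (Fin n → ℝ)}

/-- Coordinatewise projection onto `[a, b]`. -/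
def clip (a b : ℝ) (x : Fin n → ℝ) : Fin n → ℝ := fun i => max a (min b (x i))

lemma clip_mem (hab : a ≤ b) (x : Fin n → ℝ) (i : Fin n) : clip a b x i ∈ Set.Icc a b :=
  ⟨le_max_left _ _, max_le hab (min_le_left _ _)⟩

lemma clip_of_mem {x : Fin n → ℝ} (hx : ∀ i, x i ∈ Set.Icc a b) : clip a b x = x := by
  funext i
  simp [clip, (hx i).1, (hx i).2]

lemma continuous_clip : Continuous (clip a b : (Fin n → ℝ) → Fin n → ℝ) := by
  unfold clip
  fun_prop

lemma isBddMeas_comp_clip (hab : a ≤ b) {g : (Fin n → ℝ) → ℝ} (hg : Continuous g) :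
    IsBddMeas (fun x => g (clip a b x)) := by
  have hbox : IsCompact (Set.univ.pi fun _ : Fin n => Set.Icc a b) :=
    isCompact_univ_pi fun _ => isCompact_Icc
  obtain ⟨C, hC⟩ := hbox.exists_bound_of_continuousOn hg.continuousOn
  exact ⟨(hg.comp continuous_clip).measurable, C,
    fun x => hC _ fun i _ => clip_mem hab x i⟩

lemma comp_clip_ae_eq (hsupp : ∀ᵐ x ∂μ, ∀ i, x i ∈ Set.Icc a b) (g : (Fin n → ℝ) → ℝ) :
    (fun x => g (clip a b x)) =ᵐ[μ] g := by
  filter_upwards [hsupp] with x hx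
  rw [clip_of_mem hx]

lemma integrable_of_continuous_of_supp [IsProbabilityMeasure μ] (hab : a ≤ b)
    (hsupp : ∀ᵐ x ∂μ, ∀ i, x i ∈ Set.Icc a b) {g : (Fin n → ℝ) → ℝ} (hg : Continuous g) :
    Integrable g μ :=
  ((isBddMeas_comp_clip hab hg).integrable μ).congr (comp_clip_ae_eq hsupp g)

/-- The minimum of `g` over the `i`-th coordinate in `[a, b]`. -/
def coordInf (a b : ℝ) (g : (Fin n → ℝ) → ℝ) (i : Fin n) (x : Fin n → ℝ) : ℝ :=
  sInf ((fun y => g (Function.update x i y)) '' Set.Icc a b)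

lemma continuous_coordInf {g : (Fin n → ℝ) → ℝ} (hg : Continuous g) (i : Fin n) :
    Continuous (coordInf a b g i) :=
  isCompact_Icc.continuous_sInf (f := fun x y => g (Function.update x i y))
    (show Continuous fun q : (Fin n → ℝ) × ℝ => g (Function.update q.1 i q.2) by fun_prop)

lemma coordInf_le {g : (Fin n → ℝ) → ℝ} (hg : Continuous g) (i : Fin n) {x : Fin n → ℝ}
    (hx : x i ∈ Set.Icc a b) : coordInf a b g i x ≤ g x := by
  have h : Continuous fun y => g (Function.update x i y) := by fun_prop
  refine csInf_le (isCompact_Icc.image h).bddBelow ⟨x i, hx, ?_⟩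
  simp

lemma exists_coordInf_eq (hab : a ≤ b) {g : (Fin n → ℝ) → ℝ} (hg : Continuous g)
    (i : Fin n) (x : Fin n → ℝ) :
    ∃ y ∈ Set.Icc a b, coordInf a b g i x = g (Function.update x i y) :=
  isCompact_Icc.exists_sInf_image_eq (Set.nonempty_Icc.2 hab)
    (by fun_prop : Continuous fun y => g (Function.update x i y)).continuousOn

lemma coordInf_clip_update (g : (Fin n → ℝ) → ℝ) (i : Fin n) (x : Fin n → ℝ) (y : ℝ) :
    coordInf a b g i (clip a b (Function.update x i y)) = coordInf a b g i (clip a b x) := by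
  have : ∀ z, Function.update (clip a b (Function.update x i y)) i z =
      Function.update (clip a b x) i z := fun z => by
    funext j
    by_cases hj : j = i
    · subst hj; simp
    · simp [hj, clip]
  simp only [coordInf, this]

lemma lpN_posPart_Wfun_le [IsProbabilityMeasure μ] (h𝒯 : IsCompact 𝒯) (h𝒯ne : 𝒯.Nonempty)
    (hab : a < b) (hsupp : ∀ᵐ x ∂μ, ∀ i, x i ∈ Set.Icc a b)
    {ν : Fin n → (Fin n → ℝ) → Measure ℝ} {σ2 : ℝ} (hσ : 0 < σ2) (hLSI : DLSI μ ν σ2)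
    {p : ℝ} (hp : 2 ≤ p) {k : ℕ} (hk : k + 1 ≤ d) :
    lpN μ p (fun x => max (Wfun 𝒯 k x - ∫ y, Wfun 𝒯 k y ∂μ) 0) ≤
      √(2 * σ2 * (b - a) ^ 2 * (p - 3 / 2)) * lpN μ p (Wfun 𝒯 (k + 1)) := by
  have hW := continuous_Wfun h𝒯 k
  have hW' := continuous_Wfun h𝒯 (k + 1)
  have hba : 0 ≤ b - a := by linarith
  have hp0 : 0 < p := by linarith
  have key := hLSI.lpN_posPart_le
    (G := fun x => (b - a) * Wfun 𝒯 (k + 1) (clip a b x)) hσ.le (isBddMeas_comp_clip hab.le hW)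
    (isBddMeas_comp_clip hab.le (g := fun x => (b - a) * Wfun 𝒯 (k + 1) x)
      (continuous_const.mul hW'))
    (m := fun i x => coordInf a b (Wfun 𝒯 k) i (clip a b x))
    (fun i => isBddMeas_comp_clip hab.le (continuous_coordInf hW i))
    (fun i x y => coordInf_clip_update _ i x y)
    (fun i x => coordInf_le hW i (clip_mem hab.le x i))
    (fun x => by
      choose y hy hyW using fun i => exists_coordInf_eq hab.le hW i (clip a b x)
      simp only [hyW]
      refine sum_sq_Wfun_sub_update_le h𝒯 h𝒯ne hk (clip_mem hab.le x) hy fun i => ?_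
      rw [← hyW]
      exact coordInf_le hW i (clip_mem hab.le x i)) hp
  rw [lpN_const_mul hp0 hba, lpN_congr_ae (comp_clip_ae_eq hsupp (Wfun 𝒯 (k + 1))),
    integral_congr_ae (comp_clip_ae_eq hsupp (Wfun 𝒯 k)),
    lpN_congr_ae (comp_clip_ae_eq hsupp
      (fun x => max (Wfun 𝒯 k x - ∫ y, Wfun 𝒯 k y ∂μ) 0))] at key
  have hL := lpN_nonneg μ p (Wfun 𝒯 (k + 1))
  refine le_of_sq_le_sq ?_ (by positivity)
  rw [mul_pow, Real.sq_sqrt (mul_nonneg (by positivity) (by linarith))]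
  refine key.trans ?_
  have : 0 ≤ σ2 * (p - 2) * ((b - a) ^ 2 * lpN μ p (Wfun 𝒯 (k + 1)) ^ 2) :=
    mul_nonneg (mul_nonneg hσ.le (by linarith)) (by positivity)
  nlinarith

lemma lpN_Wfun_le [IsProbabilityMeasure μ] (h𝒯 : IsCompact 𝒯)
    (hab : a < b) (hsupp : ∀ᵐ x ∂μ, ∀ i, x i ∈ Set.Icc a b) {p : ℝ} (hp : 1 ≤ p) (k : ℕ) :
    lpN μ p (Wfun 𝒯 k) ≤ ∫ x, Wfun 𝒯 k x ∂μ +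
      lpN μ p (fun x => max (Wfun 𝒯 k x - ∫ y, Wfun 𝒯 k y ∂μ) 0) := by
  set c := ∫ x, Wfun 𝒯 k x ∂μ
  have hp0 : 0 < p := by linarith
  have hc : 0 ≤ c := integral_nonneg fun x => Wfun_nonneg 𝒯 k x
  have hV := isBddMeas_comp_clip hab.le (continuous_Wfun h𝒯 k)
  have hM : IsBddMeas (fun x => max (Wfun 𝒯 k (clip a b x) - c) 0) :=
    (hV.sub (.const c)).posPart
  have h1 : lpN μ p (fun x => Wfun 𝒯 k (clip a b x)) ≤
      lpN μ p (fun x => c + max (Wfun 𝒯 k (clip a b x) - c) 0) := by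
    refine lpN_mono hp0 hV ((IsBddMeas.const c).add hM) fun x => ?_
    rw [abs_of_nonneg (Wfun_nonneg _ _ _), abs_of_nonneg (add_nonneg hc (le_max_right _ _))]
    linarith [le_max_left (Wfun 𝒯 k (clip a b x) - c) 0]
  have h2 := h1.trans (lpN_add_le hp (IsBddMeas.const c) hM)
  rwa [lpN_const hp0 hc, lpN_congr_ae (comp_clip_ae_eq hsupp (Wfun 𝒯 k)),
    lpN_congr_ae (comp_clip_ae_eq hsupp (fun x => max (Wfun 𝒯 k x - c) 0))] at h2

lemma le_geom_sum_of_le_add_mul {A E : ℕ → ℝ} {c : ℝ} (hc : 0 ≤ c) {d : ℕ}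
    (h : ∀ k, k + 1 ≤ d → A k ≤ E k + c * A (k + 1)) (m : ℕ) (hm : 1 + m ≤ d) :
    A 1 ≤ ∑ j ∈ Finset.range m, c ^ j * E (1 + j) + c ^ m * A (1 + m) := by
  induction m with
  | zero => simp
  | succ m ih =>
    have h1 := mul_le_mul_of_nonneg_left (h (1 + m) (by omega)) (pow_nonneg hc m)
    have h2 := ih (by omega)
    rw [Finset.sum_range_succ, pow_succ, ← add_assoc 1 m 1]
    linarith

/-- The moment inequality for suprema of chaos. -/
lemma lpN_posPart_fSup_le [IsProbabilityMeasure μ] (hd : 1 ≤ d) (h𝒯 : IsCompact 𝒯)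
    (h𝒯ne : 𝒯.Nonempty) (hab : a < b) (hsupp : ∀ᵐ x ∂μ, ∀ i, x i ∈ Set.Icc a b)
    {ν : Fin n → (Fin n → ℝ) → Measure ℝ} {σ2 : ℝ} (hσ : 0 < σ2) (hLSI : DLSI μ ν σ2)
    {p : ℝ} (hp : 2 ≤ p) :
    lpN μ p (fun x => max (fSup 𝒯 x - ∫ y, fSup 𝒯 y ∂μ) 0) ≤
      ∑ j ∈ Finset.Icc 1 d,
        (2 * σ2 * (b - a) ^ 2 * (p - 3 / 2)) ^ ((j : ℝ) / 2) * ∫ x, Wfun 𝒯 j x ∂μ := by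
  set s := 2 * σ2 * (b - a) ^ 2 * (p - 3 / 2)
  have hs : 0 ≤ s := mul_nonneg (by positivity) (by linarith)
  have hstep : ∀ k, k + 1 ≤ d → lpN μ p (Wfun 𝒯 k) ≤
      ∫ x, Wfun 𝒯 k x ∂μ + √s * lpN μ p (Wfun 𝒯 (k + 1)) := fun k hk =>
    (lpN_Wfun_le h𝒯 hab hsupp (by linarith) k).trans (by
      gcongr
      exact lpN_posPart_Wfun_le h𝒯 h𝒯ne hab hsupp hσ hLSI hp hk)
  have hlast : lpN μ p (Wfun 𝒯 d) = ∫ x, Wfun 𝒯 d x ∂μ := by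
    have : Wfun 𝒯 d = fun _ => Wfun 𝒯 d 0 := funext fun x => Wfun_self 𝒯 x 0
    rw [this, lpN_const (by linarith) (Wfun_nonneg _ _ _)]
    simp
  have hsum := le_geom_sum_of_le_add_mul (A := fun k => lpN μ p (Wfun 𝒯 k))
    (E := fun k => ∫ x, Wfun 𝒯 k x ∂μ) (Real.sqrt_nonneg s) hstep (d - 1) (by omega)
  simp only [Nat.add_sub_cancel' hd, hlast] at hsum
  have hfirst := lpN_posPart_Wfun_le h𝒯 h𝒯ne hab hsupp hσ hLSI hp (k := 0) hd
  rw [Wfun_zero] at hfirst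
  refine hfirst.trans ((mul_le_mul_of_nonneg_left hsum (Real.sqrt_nonneg s)).trans_eq ?_)
  have hpow : ∀ j : ℕ, s ^ ((j : ℝ) / 2) = √s ^ j := fun j => by
    rw [Real.sqrt_eq_rpow, ← Real.rpow_natCast, ← Real.rpow_mul hs]
    congr 1; ring
  obtain ⟨e, rfl⟩ : ∃ e, d = e + 1 := ⟨d - 1, by omega⟩
  have hlastterm : √s ^ e * ∫ x, Wfun 𝒯 (e + 1) x ∂μ =
      √s ^ e * ∫ x, Wfun 𝒯 (1 + e) x ∂μ :=
    congrArg (fun l => √s ^ e * ∫ x, Wfun 𝒯 l x ∂μ) (add_comm e 1)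
  rw [Nat.add_sub_cancel, hlastterm, ← Finset.sum_range_succ
    (fun j => √s ^ j * ∫ x, Wfun 𝒯 (1 + j) x ∂μ), Finset.mul_sum,
    ← Finset.Ico_add_one_right_eq_Icc, Finset.sum_Ico_eq_sum_range]
  refine Finset.sum_congr rfl fun j _ => ?_
  rw [hpow, pow_add, pow_one, mul_assoc]

/-- Deviation bound with any upper bounds `V k` of the expectations of `W_k`. -/
lemma measure_fSup_sub_ge_le [IsProbabilityMeasure μ] (hd : 1 ≤ d) (h𝒯 : IsCompact 𝒯)
    (h𝒯ne : 𝒯.Nonempty) (hab : a < b) (hsupp : ∀ᵐ x ∂μ, ∀ i, x i ∈ Set.Icc a b)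
    {ν : Fin n → (Fin n → ℝ) → Measure ℝ} {σ2 : ℝ} (hσ : 0 < σ2) (hLSI : DLSI μ ν σ2)
    {V : ℕ → ℝ} (hV : ∀ k, ∫ x, Wfun 𝒯 k x ∂μ ≤ V k) {t : ℝ} (ht : 0 ≤ t) :
    μ {x | t ≤ fSup 𝒯 x - ∫ y, fSup 𝒯 y ∂μ} ≤
      ENNReal.ofReal (2 * Real.exp
        (-(1 / (2 * Real.exp 1 ^ 2 * σ2 * (b - a) ^ 2 * (d : ℝ) ^ 2)) *
          (Finset.Icc 1 d).inf' ⟨d, Finset.mem_Icc.mpr ⟨hd, le_rfl⟩⟩ (fun k =>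
            (t / V k) ^ ((2 : ℝ) / k)))) := by
  have hba : 0 < b - a := sub_pos.2 hab
  have hd0 : (0 : ℝ) < d := by exact_mod_cast hd
  have hd1 : (1 : ℝ) ≤ d := by exact_mod_cast hd
  have hV0 : ∀ k, 0 ≤ V k := fun k =>
    (integral_nonneg fun x => Wfun_nonneg 𝒯 k x).trans (hV k)
  set M := (Finset.Icc 1 d).inf' ⟨d, Finset.mem_Icc.mpr ⟨hd, le_rfl⟩⟩
    (fun k : ℕ => (t / V k) ^ ((2 : ℝ) / k)) with hM
  have hMle : ∀ k ∈ Finset.Icc 1 d, M ≤ (t / V k) ^ ((2 : ℝ) / k) := fun k hk =>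
    Finset.inf'_le _ hk
  have hM0 : 0 ≤ M :=
    Finset.le_inf' _ _ fun k _ => Real.rpow_nonneg (div_nonneg ht (hV0 k)) _
  set η := 1 / (2 * Real.exp 1 ^ 2 * σ2 * (b - a) ^ 2 * (d : ℝ) ^ 2) * M with hη
  have hη0 : 0 ≤ η := mul_nonneg (by positivity) hM0
  rw [neg_mul]
  rcases lt_or_ge η (1 / 2) with hsmall | hlarge
  · refine prob_le_one.trans ?_
    rw [← ENNReal.ofReal_one]
    refine ENNReal.ofReal_le_ofReal ?_
    have := Real.add_one_le_exp (-η)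
    linarith
  have hMpos : 0 < M := by
    rcases hM0.eq_or_lt with h0 | h0
    · rw [hη, ← h0, mul_zero] at hlarge; norm_num at hlarge
    · exact h0
  have hVpos : ∀ k ∈ Finset.Icc 1 d, 0 < V k ∧ 0 < t := by
    intro k hk
    have hk0 : (0 : ℝ) < k := by exact_mod_cast (Finset.mem_Icc.1 hk).1
    have hpos := hMpos.trans_le (hMle k hk)
    have hne : t / V k ≠ 0 := by
      intro h0
      rw [h0, Real.zero_rpow (by positivity)] at hpos
      exact hpos.false
    obtain ⟨h1, h2⟩ := div_ne_zero_iff.1 hne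
    exact ⟨(hV0 k).lt_of_ne' h2, ht.lt_of_ne' h1⟩
  have htpos : 0 < t := (hVpos d (Finset.mem_Icc.2 ⟨hd, le_rfl⟩)).2
  set p := η + 3 / 2 with hp
  have hp2 : 2 ≤ p := by linarith
  have hp0 : 0 < p := by linarith
  set c := ∫ y, fSup 𝒯 y ∂μ with hc
  set g : (Fin n → ℝ) → ℝ := fun x => max (fSup 𝒯 x - c) 0 with hg
  have hs : 2 * σ2 * (b - a) ^ 2 * (p - 3 / 2) = M / (Real.exp 1 * d) ^ 2 := by
    rw [hp, add_sub_cancel_right, hη]; field_simp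
  have hmom : lpN μ p g ≤ t / Real.exp 1 := by
    refine (lpN_posPart_fSup_le hd h𝒯 h𝒯ne hab hsupp hσ hLSI hp2).trans ?_
    rw [hs]
    have hterm : ∀ j ∈ Finset.Icc 1 d, (M / (Real.exp 1 * d) ^ 2) ^ ((j : ℝ) / 2) *
        ∫ x, Wfun 𝒯 j x ∂μ ≤ t / (Real.exp 1 * d) := by
      intro j hj
      have hj1 := (Finset.mem_Icc.1 hj).1
      have hj0 : (0 : ℝ) < j := by exact_mod_cast hj1
      obtain ⟨hVj, -⟩ := hVpos j hj
      have hed : 1 ≤ Real.exp 1 * d := one_le_mul_of_one_le_of_one_le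
        (Real.one_le_exp zero_le_one) hd1
      have h1 : M ^ ((j : ℝ) / 2) ≤ t / V j := by
        refine (Real.rpow_le_rpow hM0 (hMle j hj) (by positivity)).trans_eq ?_
        rw [← Real.rpow_mul (by positivity)]
        have : (2 : ℝ) / j * (j / 2) = 1 := by field_simp
        rw [this, Real.rpow_one]
      have h2 : Real.exp 1 * d ≤ ((Real.exp 1 * d) ^ 2) ^ ((j : ℝ) / 2) := by
        rw [← Real.rpow_natCast, ← Real.rpow_mul (by positivity)]
        have : ((2 : ℕ) : ℝ) * (j / 2) = j := by push_cast; ring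
        rw [this, Real.rpow_natCast]
        exact le_self_pow₀ hed (by omega)
      rw [Real.div_rpow hM0 (by positivity)]
      calc _ ≤ (t / V j) / (Real.exp 1 * d) * V j := by
            have := hV j
            have h0 : 0 ≤ ∫ x, Wfun 𝒯 j x ∂μ := integral_nonneg fun x => Wfun_nonneg 𝒯 j x
            gcongr
        _ = t / (Real.exp 1 * d) := by field_simp
    refine (Finset.sum_le_sum hterm).trans_eq ?_
    rw [Finset.sum_const, Nat.card_Icc, Nat.add_sub_cancel, nsmul_eq_mul]
    field_simp
  have hfc : Continuous (fSup 𝒯) := Wfun_zero 𝒯 ▸ continuous_Wfun h𝒯 0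
  have hgc : Continuous fun x => |g x| ^ p :=
    (Real.continuous_rpow_const hp0.le).comp (by fun_prop)
  have hmarkov := mul_meas_ge_le_integral_of_nonneg (μ := μ)
    (f := fun x => |g x| ^ p) (.of_forall fun x => by positivity)
    (integrable_of_continuous_of_supp hab.le hsupp hgc) (t ^ p)
  rw [← lpN_rpow hp0] at hmarkov
  have hsub : {x | t ≤ fSup 𝒯 x - c} ⊆ {x | t ^ p ≤ |g x| ^ p} := fun x hx =>
    Real.rpow_le_rpow ht ((le_max_of_le_left hx).trans (le_abs_self _)) hp0.le
  have hreal : μ.real {x | t ^ p ≤ |g x| ^ p} ≤ Real.exp (-p) := by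
    have h1 : lpN μ p g ^ p ≤ t ^ p * Real.exp (-p) := by
      refine (Real.rpow_le_rpow (lpN_nonneg _ _ _) hmom hp0.le).trans_eq ?_
      rw [Real.div_rpow ht (Real.exp_pos _).le, Real.exp_one_rpow, Real.exp_neg,
        div_eq_mul_inv]
    exact le_of_mul_le_mul_left (hmarkov.trans h1) (by positivity)
  calc μ {x | t ≤ fSup 𝒯 x - c} ≤ μ {x | t ^ p ≤ |g x| ^ p} := measure_mono hsub
    _ = ENNReal.ofReal (μ.real {x | t ^ p ≤ |g x| ^ p}) := (ofReal_measureReal).symm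
    _ ≤ _ := by
      refine ENNReal.ofReal_le_ofReal (hreal.trans ?_)
      have h1 : Real.exp (-p) ≤ Real.exp (-η) := Real.exp_le_exp.2 (by linarith)
      linarith [Real.exp_pos (-η)]

end ClippedChaos

/-- moment and deviation inequalities for suprema of Banach-space valued
homogeneous chaos under a `𝔡`-LSI (Theorem `theorem:ChaosInIndependentOrPartialLSI`). -/
theorem stmt5 {n d : ℕ} (hd : 1 ≤ d) {B : Type*} [NormedAddCommGroup B] [NormedSpace ℝ B]
    (𝒯 : Set (IdxSet n d → B)) (h𝒯c : IsCompact 𝒯) (h𝒯ne : 𝒯.Nonempty)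
    (a b : ℝ) (hab : a < b)
    (μ : Measure (Fin n → ℝ)) (hμ : IsProbabilityMeasure μ)
    (hsupp : ∀ᵐ x ∂μ, ∀ i, x i ∈ Set.Icc a b)
    (ν : ∀ i : Fin n, (Fin n → ℝ) → Measure ℝ) (σ2 : ℝ) (hσ : 0 < σ2)
    (hLSI : DLSI μ ν σ2) :
    (∀ p : ℝ, 2 ≤ p →
      lpN μ p (fun x => max (fSup 𝒯 x - ∫ y, fSup 𝒯 y ∂μ) 0) ≤
        ∑ j ∈ Finset.Icc 1 d,
          (2 * σ2 * (b - a) ^ 2 * (p - 3 / 2)) ^ ((j : ℝ) / 2) * ∫ x, Wfun 𝒯 j x ∂μ) ∧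
    (∀ t : ℝ, 0 ≤ t →
      μ {x | t ≤ fSup 𝒯 x - ∫ y, fSup 𝒯 y ∂μ} ≤
        ENNReal.ofReal (2 * Real.exp
          (-(1 / (2 * Real.exp 1 ^ 2 * σ2 * (b - a) ^ 2 * (d : ℝ) ^ 2)) *
            (Finset.Icc 1 d).inf' ⟨d, Finset.mem_Icc.mpr ⟨hd, le_rfl⟩⟩ (fun k =>
              (t / ∫ x, Wfun 𝒯 k x ∂μ) ^ ((2 : ℝ) / k))))) ∧
    (∀ t : ℝ, 0 ≤ t →
      μ {x | t ≤ fSup 𝒯 x - ∫ y, fSup 𝒯 y ∂μ} ≤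
        ENNReal.ofReal (2 * Real.exp
          (-(1 / (2 * Real.exp 1 ^ 2 * σ2 * (b - a) ^ 2 * (d : ℝ) ^ 2)) *
            (Finset.Icc 1 d).inf' ⟨d, Finset.mem_Icc.mpr ⟨hd, le_rfl⟩⟩ (fun k =>
              (t / ∫ x, Wtil 𝒯 k x ∂μ) ^ ((2 : ℝ) / k))))) := by
  have := hμ
  refine ⟨fun p hp => lpN_posPart_fSup_le hd h𝒯c h𝒯ne hab hsupp hσ hLSI hp,
    fun t ht => measure_fSup_sub_ge_le hd h𝒯c h𝒯ne hab hsupp hσ hLSI (fun _ => le_rfl) ht,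
    fun t ht => measure_fSup_sub_ge_le hd h𝒯c h𝒯ne hab hsupp hσ hLSI
      (V := fun k => ∫ x, Wtil 𝒯 k x ∂μ) (fun k => ?_) ht⟩
  exact integral_mono
    (integrable_of_continuous_of_supp hab.le hsupp (continuous_Wfun h𝒯c k))
    (integrable_of_continuous_of_supp hab.le hsupp (continuous_Wtil h𝒯c k))
    (Wfun_le_Wtil h𝒯c h𝒯ne k)

end
end

section
/- Let X_1,…,X_n be independent Rademacher random variables (ℙ(X_i = 1) = ℙ(X_i = −1) = 1/2), let d ∈ ℕ with d ≤ n, and let f : {−1,+1}^n → ℝ be a function of degree at most d, i.e. f(x) = Σ_{S ⊆ [n], |S| ≤ d} f̂_S x_S in the Fourier–Walsh basis. Then for all t > 0, ℙ( |f(X) − 𝔼 f(X)| ≥ t ) ≤ exp( 1 − min_{j=1,…,d} ( t / (d e W_j(f)^{1/2}) )^{2/j} ). -/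
open MeasureTheory Finset Real

noncomputable section

/-- The character `χ(b) = ±1`. -/
def rad (b : Bool) : ℝ := if b then 1 else -1

/-- A function on the Boolean hypercube given by its Fourier–Walsh expansion. -/
def fourierFn {n : ℕ} (fhat : Finset (Fin n) → ℝ) (ω : Fin n → Bool) : ℝ :=
  ∑ S : Finset (Fin n), fhat S * ∏ i ∈ S, rad (ω i)

/-- Fourier weight of order `j`. -/
def fourierWeight {n : ℕ} (fhat : Finset (Fin n) → ℝ) (j : ℕ) : ℝ :=
  ∑ S ∈ Finset.univ.filter (fun S : Finset (Fin n) => S.card = j), fhat S ^ 2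

section Minkowski

/-- Minkowski's inequality for natural exponents, with the norms replaced by upper bounds. -/
theorem sum_add_pow_le_of_sum_pow_le {κ : Type*} (s : Finset κ) {a b : κ → ℝ}
    (ha : ∀ i, 0 ≤ a i) (hb : ∀ i, 0 ≤ b i) {A B N : ℝ} (hA : 0 ≤ A) (hB : 0 ≤ B) (hN : 0 ≤ N)
    {m : ℕ} (hm : 1 ≤ m) (hsa : ∑ i ∈ s, a i ^ m ≤ N * A ^ m)
    (hsb : ∑ i ∈ s, b i ^ m ≤ N * B ^ m) :
    ∑ i ∈ s, (a i + b i) ^ m ≤ N * (A + B) ^ m := by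
  have hm0 : m ≠ 0 := by omega
  have hroot : ∀ {C D : ℝ}, 0 ≤ C → 0 ≤ D → D ≤ N * C ^ m →
      D ^ (1 / (m : ℝ)) ≤ N ^ (1 / (m : ℝ)) * C := by
    intro C D hC hD h
    calc D ^ (1 / (m : ℝ)) ≤ (N * C ^ m) ^ (1 / (m : ℝ)) :=
          Real.rpow_le_rpow hD h (by positivity)
      _ = N ^ (1 / (m : ℝ)) * C := by
          rw [Real.mul_rpow hN (by positivity), one_div, Real.pow_rpow_inv_natCast hC hm0]
  have hsum := Real.Lp_add_le_of_nonneg (s := s) (p := (m : ℝ)) (by exact_mod_cast hm)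
    (fun i _ => ha i) (fun i _ => hb i)
  simp only [Real.rpow_natCast] at hsum
  have hle : (∑ i ∈ s, (a i + b i) ^ m) ^ (1 / (m : ℝ)) ≤ N ^ (1 / (m : ℝ)) * (A + B) := by
    rw [mul_add]
    exact hsum.trans (add_le_add
      (hroot hA (sum_nonneg fun i _ => pow_nonneg (ha i) m) hsa)
      (hroot hB (sum_nonneg fun i _ => pow_nonneg (hb i) m) hsb))
  have h0 : 0 ≤ ∑ i ∈ s, (a i + b i) ^ m :=
    sum_nonneg fun i _ => pow_nonneg (add_nonneg (ha i) (hb i)) m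
  have hpow := pow_le_pow_left₀ (by positivity) hle m
  rwa [mul_pow, one_div, Real.rpow_inv_natCast_pow h0 hm0,
    Real.rpow_inv_natCast_pow hN hm0] at hpow

end Minkowski

section TwoPoint

theorem sum_range_two_mul_add_one (F : ℕ → ℝ) (m : ℕ) :
    ∑ j ∈ range (2 * m + 1), F j =
      ∑ k ∈ range (m + 1), F (2 * k) + ∑ k ∈ range m, F (2 * k + 1) := by
  induction m with
  | zero => simp
  | succ m ih =>
    rw [show 2 * (m + 1) + 1 = 2 * m + 1 + 1 + 1 by ring, sum_range_succ, sum_range_succ, ih,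
      sum_range_succ _ (m + 1),
      sum_range_succ (fun k => F (2 * k + 1)) m, show 2 * (m + 1) = 2 * m + 1 + 1 by ring]
    ring

theorem add_pow_add_sub_pow_two_mul (x y : ℝ) (m : ℕ) :
    (x + y) ^ (2 * m) + (x - y) ^ (2 * m) =
      2 * ∑ k ∈ range (m + 1), (x ^ 2) ^ (m - k) * (y ^ 2) ^ k * ((2 * m).choose (2 * k) : ℝ) := by
  rw [sub_eq_add_neg, add_comm x y, add_comm x (-y), add_pow, add_pow, ← sum_add_distrib,
    sum_range_two_mul_add_one, mul_sum]
  rw [sum_eq_zero (s := range m), add_zero]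
  · refine sum_congr rfl fun k _ => ?_
    rw [(even_two_mul k).neg_pow, ← pow_mul, ← pow_mul, Nat.mul_sub]
    ring
  · intro k _
    rw [Odd.neg_pow ⟨k, rfl⟩]
    ring

theorem choose_two_mul_two_mul_le {m k : ℕ} (hk : k ≤ m) :
    ((2 * m).choose (2 * k) : ℝ) ≤ (2 * m - 1) ^ k * (m.choose k : ℝ) := by
  induction k with
  | zero => simp
  | succ k ih =>
    have ih := ih (by omega)
    have e1 := Nat.choose_succ_right_eq (2 * m) (2 * k)
    have e2 := Nat.choose_succ_right_eq (2 * m) (2 * k + 1)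
    have e3 := Nat.choose_succ_right_eq m k
    obtain ⟨r, rfl⟩ : ∃ r, m = k + 1 + r := ⟨m - (k + 1), by omega⟩
    rw [show 2 * (k + 1 + r) - 2 * k = 2 * r + 2 by omega] at e1
    rw [show 2 * (k + 1 + r) - (2 * k + 1) = 2 * r + 1 by omega] at e2
    rw [show k + 1 + r - k = r + 1 by omega] at e3
    rw [show 2 * (k + 1) = 2 * k + 1 + 1 by ring]
    apply_fun (Nat.cast : ℕ → ℝ) at e1 e2 e3
    push_cast at e1 e2 e3 ih ⊢
    set u := ((2 * (k + 1 + r)).choose (2 * k) : ℝ)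
    set v := ((2 * (k + 1 + r)).choose (2 * k + 1) : ℝ)
    set w := ((2 * (k + 1 + r)).choose (2 * k + 1 + 1) : ℝ)
    set c := ((k + 1 + r).choose k : ℝ)
    set c' := ((k + 1 + r).choose (k + 1) : ℝ)
    have hk0 : (0 : ℝ) ≤ k := by positivity
    have hr0 : (0 : ℝ) ≤ r := by positivity
    have hu : 0 ≤ u := by positivity
    have hw : 0 ≤ w := by positivity
    have hq : (0 : ℝ) ≤ 2 * (k + 1 + r) - 1 := by linarith
    have hratio : w * ((2 * k + 1) * (k + 1)) = u * ((r + 1) * (2 * r + 1)) := by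
      linear_combination ((2 * k + 1 : ℝ) / 2) * e2 + ((2 * r + 1 : ℝ) / 2) * e1
    have hstep : w * (k + 1) ≤ (2 * (k + 1 + r) - 1) ^ (k + 1) * c' * (k + 1) := by
      calc w * (k + 1) ≤ w * ((2 * k + 1) * (k + 1)) := by
            refine mul_le_mul_of_nonneg_left ?_ hw
            nlinarith
        _ = u * ((r + 1) * (2 * r + 1)) := hratio
        _ ≤ u * ((r + 1) * (2 * (k + 1 + r) - 1)) := by
            gcongr
            linarith
        _ ≤ ((2 * (k + 1 + r) - 1) ^ k * c) * ((r + 1) * (2 * (k + 1 + r) - 1)) := by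
            gcongr
        _ = (2 * (k + 1 + r) - 1) ^ (k + 1) * c' * (k + 1) := by
            rw [mul_assoc _ c', e3]
            ring
    exact le_of_mul_le_mul_right hstep (by positivity)

/-- The two-point hypercontractive inequality for even exponents. -/
theorem add_pow_add_sub_pow_le (x y : ℝ) (m : ℕ) :
    (x + y) ^ (2 * m) + (x - y) ^ (2 * m) ≤ 2 * (x ^ 2 + (2 * m - 1) * y ^ 2) ^ m := by
  rw [add_pow_add_sub_pow_two_mul, add_comm (x ^ 2), add_pow]
  refine mul_le_mul_of_nonneg_left (sum_le_sum fun k hk => ?_) (by norm_num)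
  have hk : k ≤ m := by simpa [Nat.lt_succ_iff] using hk
  rw [mul_pow]
  calc (x ^ 2) ^ (m - k) * (y ^ 2) ^ k * ((2 * m).choose (2 * k) : ℝ)
      ≤ (x ^ 2) ^ (m - k) * (y ^ 2) ^ k * ((2 * m - 1) ^ k * (m.choose k : ℝ)) :=
        mul_le_mul_of_nonneg_left (choose_two_mul_two_mul_le hk) (by positivity)
    _ = (2 * m - 1) ^ k * (y ^ 2) ^ k * (x ^ 2) ^ (m - k) * (m.choose k : ℝ) := by ring

end TwoPoint

section Walsh

variable {ι : Type*} [DecidableEq ι]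

/-- Flips the sign of the coordinate `a`. -/
def flipAt (a : ι) (ω : ι → Bool) : ι → Bool := Function.update ω a (!ω a)

theorem flipAt_involutive (a : ι) : Function.Involutive (flipAt a) := by
  intro ω
  simp [flipAt]

theorem rad_flipAt_self (a : ι) (ω : ι → Bool) : rad (flipAt a ω a) = -rad (ω a) := by
  cases h : ω a <;> simp [flipAt, rad, h]

theorem prod_rad_flipAt {a : ι} {S : Finset ι} (ha : a ∉ S) (ω : ι → Bool) :
    ∏ i ∈ S, rad (flipAt a ω i) = ∏ i ∈ S, rad (ω i) := by
  refine prod_congr rfl fun i hi => ?_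
  rw [flipAt, Function.update_of_ne (by rintro rfl; exact ha hi)]

theorem rad_sq (b : Bool) : rad b ^ 2 = 1 := by
  cases b <;> simp [rad]

/-- The Walsh polynomial with coefficients `c` in the variables indexed by `T`. -/
def walshSum (T : Finset ι) (c : Finset ι → ℝ) (ω : ι → Bool) : ℝ :=
  ∑ S ∈ T.powerset, c S * ∏ i ∈ S, rad (ω i)

theorem walshSum_flipAt {a : ι} {T : Finset ι} (ha : a ∉ T) (c : Finset ι → ℝ) (ω : ι → Bool) :
    walshSum T c (flipAt a ω) = walshSum T c ω :=
  sum_congr rfl fun S hS => by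
    rw [prod_rad_flipAt (fun h => ha (mem_powerset.mp hS h))]

theorem walshSum_insert {a : ι} {T : Finset ι} (ha : a ∉ T) (c : Finset ι → ℝ) (ω : ι → Bool) :
    walshSum (insert a T) c ω =
      walshSum T c ω + rad (ω a) * walshSum T (fun S => c (insert a S)) ω := by
  rw [walshSum, sum_powerset_insert ha, walshSum, walshSum, mul_sum]
  congr 1
  refine sum_congr rfl fun S hS => ?_
  rw [prod_insert (fun h => ha (mem_powerset.mp hS h))]
  ring

variable [Fintype ι]

theorem sum_comp_flipAt (a : ι) (F : (ι → Bool) → ℝ) : ∑ ω, F (flipAt a ω) = ∑ ω, F ω :=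
  Equiv.sum_comp (flipAt_involutive a).toPerm F

theorem sum_prod_rad_eq_zero {S : Finset ι} (hS : S.Nonempty) :
    ∑ ω : ι → Bool, ∏ i ∈ S, rad (ω i) = 0 := by
  obtain ⟨a, ha⟩ := hS
  have h := sum_comp_flipAt a fun ω => ∏ i ∈ S, rad (ω i)
  have hneg : ∀ ω : ι → Bool, ∏ i ∈ S, rad (flipAt a ω i) = -∏ i ∈ S, rad (ω i) := by
    intro ω
    rw [← mul_prod_erase S _ ha, ← mul_prod_erase S (fun i => rad (ω i)) ha, rad_flipAt_self,
      prod_rad_flipAt (notMem_erase a S), neg_mul]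
  simp only [hneg, sum_neg_distrib] at h
  linarith

/-- Hypercontractivity on the hypercube for even exponents. -/
theorem sum_walshSum_pow_le {m : ℕ} (hm : 1 ≤ m) (T : Finset ι) (c : Finset ι → ℝ) :
    ∑ ω : ι → Bool, walshSum T c ω ^ (2 * m) ≤
      Fintype.card (ι → Bool) * (∑ S ∈ T.powerset, (2 * m - 1 : ℝ) ^ #S * c S ^ 2) ^ m := by
  have hq : (0 : ℝ) ≤ 2 * m - 1 := by
    have : (1 : ℝ) ≤ m := by exact_mod_cast hm
    linarith
  induction T using Finset.induction_on generalizing c with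
  | empty => simp [walshSum, pow_mul]
  | insert a T ha ih =>
    set g := walshSum T c
    set h := walshSum T fun S => c (insert a S)
    set q : ℝ := 2 * m - 1
    have hsym : ∑ ω : ι → Bool, walshSum (insert a T) c ω ^ (2 * m) ≤
        ∑ ω : ι → Bool, (g ω ^ 2 + q * h ω ^ 2) ^ m := by
      have hflip := sum_comp_flipAt a fun ω => walshSum (insert a T) c ω ^ (2 * m)
      have hpt : ∑ ω : ι → Bool, (walshSum (insert a T) c ω ^ (2 * m) +
          walshSum (insert a T) c (flipAt a ω) ^ (2 * m)) ≤
          ∑ ω : ι → Bool, 2 * (g ω ^ 2 + q * h ω ^ 2) ^ m := by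
        refine sum_le_sum fun ω _ => ?_
        have := add_pow_add_sub_pow_le (g ω) (rad (ω a) * h ω) m
        rw [mul_pow, rad_sq, one_mul] at this
        rwa [walshSum_insert ha, walshSum_insert ha, walshSum_flipAt ha, walshSum_flipAt ha,
          rad_flipAt_self, neg_mul, ← sub_eq_add_neg]
      rw [sum_add_distrib, hflip, ← mul_sum] at hpt
      linarith
    have hsplit : ∑ S ∈ (insert a T).powerset, q ^ #S * c S ^ 2 =
        ∑ S ∈ T.powerset, q ^ #S * c S ^ 2 +
          q * ∑ S ∈ T.powerset, q ^ #S * c (insert a S) ^ 2 := by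
      rw [sum_powerset_insert ha, mul_sum]
      congr 1
      refine sum_congr rfl fun S hS => ?_
      rw [card_insert_of_notMem (fun h => ha (mem_powerset.mp hS h))]
      ring
    have hnonneg : ∀ c' : Finset ι → ℝ, 0 ≤ ∑ S ∈ T.powerset, q ^ #S * c' S ^ 2 :=
      fun c' => sum_nonneg fun S _ => by positivity
    rw [hsplit]
    refine hsym.trans (sum_add_pow_le_of_sum_pow_le _ (fun ω => sq_nonneg _)
      (fun ω => by positivity) (hnonneg c) (mul_nonneg hq (hnonneg _)) (by positivity) hm ?_ ?_)
    · simpa only [← pow_mul] using ih c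
    · simp only [mul_pow, ← pow_mul, ← mul_sum]
      rw [mul_left_comm]
      exact mul_le_mul_of_nonneg_left (ih _) (by positivity)

end Walsh

section Concentration

theorem integral_uniformOfFintype {Ω : Type*} [Fintype Ω] [Nonempty Ω] [MeasurableSpace Ω]
    [MeasurableSingletonClass Ω] (F : Ω → ℝ) :
    ∫ ω, F ω ∂(PMF.uniformOfFintype Ω).toMeasure = (Fintype.card Ω : ℝ)⁻¹ * ∑ ω, F ω := by
  rw [PMF.integral_eq_sum, mul_sum]
  simp

variable {n : ℕ}

theorem fourierFn_eq_walshSum (c : Finset (Fin n) → ℝ) : fourierFn c = walshSum univ c := by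
  funext ω
  simp [fourierFn, walshSum]

theorem integral_fourierFn (c : Finset (Fin n) → ℝ) :
    ∫ ω, fourierFn c ω ∂(PMF.uniformOfFintype (Fin n → Bool)).toMeasure = c ∅ := by
  rw [integral_uniformOfFintype]
  simp only [fourierFn]
  rw [sum_comm, sum_eq_single ∅]
  · simp
  · intro S _ hS
    rw [← mul_sum, sum_prod_rad_eq_zero (nonempty_iff_ne_empty.mpr hS), mul_zero]
  · simp

theorem fourierFn_sub_coeff_empty (c : Finset (Fin n) → ℝ) (ω : Fin n → Bool) :
    fourierFn c ω - c ∅ = fourierFn (Function.update c ∅ 0) ω := by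
  simp only [fourierFn]
  rw [← add_sum_erase univ _ (mem_univ ∅), ← add_sum_erase univ
    (fun S => Function.update c ∅ 0 S * ∏ i ∈ S, rad (ω i)) (mem_univ ∅)]
  simp only [prod_empty, mul_one, Function.update_self, zero_add, add_sub_cancel_left]
  refine sum_congr rfl fun S hS => ?_
  rw [Function.update_of_ne (ne_of_mem_erase hS)]

theorem sum_pow_card_mul_sq_eq {d : ℕ} {c : Finset (Fin n) → ℝ}
    (hdeg : ∀ S : Finset (Fin n), d < #S → c S = 0) (q : ℝ) :
    ∑ S : Finset (Fin n), q ^ #S * Function.update c ∅ 0 S ^ 2 =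
      ∑ j ∈ Icc 1 d, q ^ j * fourierWeight c j := by
  simp only [fourierWeight, mul_sum, sum_filter]
  rw [sum_comm]
  refine sum_congr rfl fun S _ => ?_
  simp only [mul_ite, mul_zero, sum_ite_eq]
  rcases S.eq_empty_or_nonempty with rfl | hS
  · simp
  · have h1 : 1 ≤ #S := hS.card_pos
    rw [Function.update_of_ne hS.ne_empty]
    split_ifs with h
    · rfl
    · rw [hdeg S (by simpa [h1] using h)]
      simp

/-- Moment bound for the centred function in terms of the Fourier weights. -/
theorem integral_sub_integral_pow_le {d m : ℕ} (hm : 1 ≤ m) {c : Finset (Fin n) → ℝ}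
    (hdeg : ∀ S : Finset (Fin n), d < #S → c S = 0) :
    ∫ ω, (fourierFn c ω - c ∅) ^ (2 * m) ∂(PMF.uniformOfFintype (Fin n → Bool)).toMeasure ≤
      (∑ j ∈ Icc 1 d, (2 * m - 1 : ℝ) ^ j * fourierWeight c j) ^ m := by
  simp only [fourierFn_sub_coeff_empty]
  rw [integral_uniformOfFintype, fourierFn_eq_walshSum, ← sum_pow_card_mul_sq_eq hdeg,
    inv_mul_le_iff₀ (by exact_mod_cast Fintype.card_pos)]
  simpa using sum_walshSum_pow_le hm (univ : Finset (Fin n)) (Function.update c ∅ 0)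

theorem fourierWeight_nonneg (c : Finset (Fin n) → ℝ) (j : ℕ) : 0 ≤ fourierWeight c j :=
  sum_nonneg fun _ _ => sq_nonneg _

/-- If `q` is at most the `j`-th tail exponent, then `q ^ j * W` is at most `(t / (d e)) ^ 2`. -/
theorem pow_mul_le_of_le_rpow {t K W q : ℝ} (hK : 0 < K) (ht : 0 < t) (hW : 0 ≤ W) (hq : 0 ≤ q)
    {j : ℕ} (hj : 1 ≤ j) (h : q ≤ (t / (K * √W)) ^ ((2 : ℝ) / j)) :
    q ^ j * W ≤ (t / K) ^ 2 := by
  rcases hW.eq_or_lt with rfl | hW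
  · simpa using sq_nonneg (t / K)
  have hj0 : (j : ℝ) ≠ 0 := by positivity
  have hpow : q ^ j ≤ (t / (K * √W)) ^ 2 := by
    refine (pow_le_pow_left₀ hq h j).trans_eq ?_
    rw [← Real.rpow_natCast, ← Real.rpow_mul (by positivity), div_mul_cancel₀ _ hj0,
      Real.rpow_ofNat]
  calc q ^ j * W ≤ (t / (K * √W)) ^ 2 * W := by gcongr
    _ = (t / K) ^ 2 := by
      rw [← div_div, div_pow (t / K), Real.sq_sqrt hW.le, div_mul_cancel₀ _ hW.ne']

theorem measure_le_abs_le_of_moment_le {Ω : Type*} [Finite Ω] [MeasurableSpace Ω]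
    [MeasurableSingletonClass Ω] (μ : Measure Ω) [IsFiniteMeasure μ] (F : Ω → ℝ) {t M : ℝ}
    (ht : 0 < t) {m : ℕ} (hM : ∫ ω, F ω ^ (2 * m) ∂μ ≤ M * t ^ (2 * m)) :
    μ {ω | t ≤ |F ω|} ≤ ENNReal.ofReal M := by
  have hmarkov := mul_meas_ge_le_integral_of_nonneg (μ := μ) (f := fun ω => F ω ^ (2 * m))
    (.of_forall fun ω => (even_two_mul m).pow_nonneg _) .of_finite (t ^ (2 * m))
  have hsub : μ.real {ω | t ≤ |F ω|} ≤ μ.real {ω | t ^ (2 * m) ≤ F ω ^ (2 * m)} := by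
    refine measureReal_mono fun ω hω => ?_
    rw [Set.mem_ofPred_eq, ← (even_two_mul m).pow_abs (F ω)]
    exact pow_le_pow_left₀ ht.le hω _
  have hpos : 0 < t ^ (2 * m) := by positivity
  have hreal : μ.real {ω | t ≤ |F ω|} ≤ M := by
    refine le_of_mul_le_mul_right ?_ hpos
    calc μ.real {ω | t ≤ |F ω|} * t ^ (2 * m)
        ≤ t ^ (2 * m) * μ.real {ω | t ^ (2 * m) ≤ F ω ^ (2 * m)} := by
          rw [mul_comm]
          gcongr
      _ ≤ M * t ^ (2 * m) := hmarkov.trans hM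
  rw [← ofReal_measureReal]
  exact ENNReal.ofReal_le_ofReal hreal

end Concentration

/-- multilevel concentration on the Boolean hypercube in terms of Fourier
weights (Proposition `proposition:RademacherAsHypercube`). -/
theorem stmt7 {n : ℕ} (d : ℕ) (hd1 : 1 ≤ d) (hdn : d ≤ n)
    (fhat : Finset (Fin n) → ℝ) (hdeg : ∀ S : Finset (Fin n), d < S.card → fhat S = 0)
    (t : ℝ) (ht : 0 < t) :
    (PMF.uniformOfFintype (Fin n → Bool)).toMeasure
        {ω | t ≤ |fourierFn fhat ω -
          ∫ ω', fourierFn fhat ω' ∂(PMF.uniformOfFintype (Fin n → Bool)).toMeasure|} ≤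
      ENNReal.ofReal (Real.exp (1 -
        (Finset.Icc 1 d).inf' ⟨d, Finset.mem_Icc.mpr ⟨hd1, le_rfl⟩⟩ (fun j =>
          (t / ((d : ℝ) * Real.exp 1 * Real.sqrt (fourierWeight fhat j))) ^ ((2 : ℝ) / j)))) := by
  set η := (Finset.Icc 1 d).inf' ⟨d, Finset.mem_Icc.mpr ⟨hd1, le_rfl⟩⟩ (fun j =>
    (t / ((d : ℝ) * Real.exp 1 * Real.sqrt (fourierWeight fhat j))) ^ ((2 : ℝ) / j))
  rcases le_or_gt η 1 with hη1 | hη1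
  · refine prob_le_one.trans ?_
    rw [ENNReal.one_le_ofReal, Real.one_le_exp_iff]
    linarith
  obtain ⟨m, hm, hmη, hηm⟩ : ∃ m : ℕ, 1 ≤ m ∧ 2 * (m : ℝ) - 1 ≤ η ∧ η ≤ 2 * m + 1 := by
    refine ⟨⌊(η + 1) / 2⌋₊, Nat.le_floor (by push_cast; linarith), ?_, ?_⟩
    · linarith [Nat.floor_le (show 0 ≤ (η + 1) / 2 by linarith)]
    · linarith [Nat.lt_floor_add_one ((η + 1) / 2)]
  have hd : (1 : ℝ) ≤ d := by exact_mod_cast hd1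
  have hq : (0 : ℝ) ≤ 2 * m - 1 := by
    have : (1 : ℝ) ≤ m := by exact_mod_cast hm
    linarith
  rw [integral_fourierFn]
  refine (measure_le_abs_le_of_moment_le _ _ (M := Real.exp (-(2 * m))) (m := m) ht ?_).trans
    (ENNReal.ofReal_le_ofReal (Real.exp_le_exp.mpr (by linarith)))
  have hterm : ∀ j ∈ Icc 1 d, (2 * m - 1 : ℝ) ^ j * fourierWeight fhat j ≤
      (t / (d * Real.exp 1)) ^ 2 := fun j hj =>
    pow_mul_le_of_le_rpow (by positivity) ht (fourierWeight_nonneg fhat j) hq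
      (mem_Icc.mp hj).1 (hmη.trans (inf'_le _ hj))
  have hsum : ∑ j ∈ Icc 1 d, (2 * m - 1 : ℝ) ^ j * fourierWeight fhat j ≤
      (t / Real.exp 1) ^ 2 := by
    calc ∑ j ∈ Icc 1 d, (2 * m - 1 : ℝ) ^ j * fourierWeight fhat j
        ≤ d * (t / (d * Real.exp 1)) ^ 2 := by
          simpa using sum_le_card_nsmul _ _ _ hterm
      _ = (t / Real.exp 1) ^ 2 / d := by field_simp
      _ ≤ (t / Real.exp 1) ^ 2 := div_le_self (sq_nonneg _) hd
  calc ∫ ω, (fourierFn fhat ω - fhat ∅) ^ (2 * m)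
        ∂(PMF.uniformOfFintype (Fin n → Bool)).toMeasure
      ≤ (∑ j ∈ Icc 1 d, (2 * m - 1 : ℝ) ^ j * fourierWeight fhat j) ^ m :=
        integral_sub_integral_pow_le hm hdeg
    _ ≤ ((t / Real.exp 1) ^ 2) ^ m :=
        pow_le_pow_left₀ (sum_nonneg fun j _ =>
          mul_nonneg (pow_nonneg hq j) (fourierWeight_nonneg fhat j)) hsum m
    _ = Real.exp (-(2 * m)) * t ^ (2 * m) := by
        rw [← pow_mul, div_pow, ← Real.exp_nat_mul, Real.exp_neg]
        push_cast
        rw [mul_one, div_eq_inv_mul]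

end
end
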